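/- arXiv:1309.7903 — 4 statements merged into one kernel-verified Lean document; each statement's English description precedes it below -/
import Mathlib

section
/- Let n : ℕ → ℕ be strictly increasing with n 0 ≥ 5, and let G = Π i, alternatingGroup (Fin (n i)). Fix k : ℕ. Then the intersection Λ_G(n k − 1) of all subgroups of G of finite index at most n k − 1 is contained in the subgroup {g ∈ G | ∀ i < k, g i = 1} (the kernel of the projection onto the first k coordinates). Consequently i_G(n k − 1) ≥ ∏_{i < k} Nat.card (alternatingGroup (Fin (n i))). -/
/-- `Λ_G(n)`: the intersection of all subgroups of `G` of finite index at most `n`. -/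
def interLambda (G : Type*) [Group G] (n : ℕ) : Subgroup G :=
  ⨅ (H : Subgroup G) (_ : H.index ≠ 0 ∧ H.index ≤ n), H

/-- The intersection growth function `i_G(n)`. -/
noncomputable def interGrowth (G : Type*) [Group G] (n : ℕ) : ℕ :=
  (interLambda G n).index

/-- The subgroup of a product of groups consisting of elements that are trivial in
the first `k` coordinates (the kernel of the projection onto the first `k` coordinates). -/
def kerFirstCoords {G : ℕ → Type*} [∀ i, Group (G i)] (k : ℕ) :
    Subgroup (∀ i, G i) where
  carrier := {g | ∀ i < k, g i = 1}
  one_mem' := fun _ _ => rfl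
  mul_mem' := by
    intro a b ha hb i hi
    rw [Pi.mul_apply, ha i hi, hb i hi, one_mul]
  inv_mem' := by
    intro a ha i hi
    rw [Pi.inv_apply, ha i hi, inv_one]

open scoped Pointwise
open Equiv

def expSet (p : ℕ) (G : Type*) [Group G] : Set G := {x | x ^ p = 1}

theorem one_mem_expSet (p : ℕ) (G : Type*) [Group G] : (1 : G) ∈ expSet p G := one_pow p

theorem expSet_pow_mono (p : ℕ) (G : Type*) [Group G] {L M : ℕ} (h : L ≤ M) :
    expSet p G ^ L ⊆ expSet p G ^ M :=
  Set.pow_subset_pow_right (one_mem_expSet p G) h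

theorem map_mem_expSet_pow {p : ℕ} {G H : Type*} [Group G] [Group H] (f : G →* H) (L : ℕ) :
    ∀ x ∈ expSet p G ^ L, f x ∈ expSet p H ^ L := by
  induction L with
  | zero => intro x hx; simp at hx; simp [hx]
  | succ L ih =>
    intro x hx
    rw [pow_succ, Set.mem_mul] at hx
    obtain ⟨y, hy, z, hz, rfl⟩ := hx
    rw [pow_succ, map_mul]
    refine Set.mul_mem_mul (ih y hy) ?_
    change f z ^ p = 1
    rw [← map_pow, show z ^ p = 1 from hz, map_one]

theorem pi_mem_expSet_pow {p : ℕ} {ι : Type*} {G : ι → Type*} [∀ i, Group (G i)] (L : ℕ) :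
    ∀ g : ∀ i, G i, (∀ i, g i ∈ expSet p (G i) ^ L) → g ∈ expSet p (∀ i, G i) ^ L := by
  induction L with
  | zero => intro x hx; simp at hx; simp; ext i; exact hx i
  | succ L ih =>
    intro x hx
    simp only [pow_succ, Set.mem_mul] at hx
    choose y hy z hz h using hx
    rw [pow_succ, Set.mem_mul]
    refine ⟨y, ih y hy, z, ?_, funext h⟩
    exact funext fun i => hz i

theorem map_eq_one_of_mem_expSet_pow {p : ℕ} {G F : Type*} [Group G] [Group F]
    (hp : p.Coprime (Nat.card F)) (f : G →* F) (L : ℕ) :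
    ∀ x ∈ expSet p G ^ L, f x = 1 := by
  intro x hx
  have h := map_mem_expSet_pow f L x hx
  have h1 : expSet p F = {1} := by
    ext z
    constructor
    · intro hz
      have h1 : orderOf z ∣ p := orderOf_dvd_of_pow_eq_one hz
      have h2 : orderOf z ∣ Nat.card F := orderOf_dvd_natCard z
      have := Nat.eq_one_of_dvd_coprimes hp h1 h2
      simpa using this
    · rintro rfl; exact one_mem_expSet p F
  rw [h1] at h
  simpa using h

theorem exists_involutions {α : Type*} (g : Perm α) :
    ∃ a b : Perm α, a * a = 1 ∧ b * b = 1 ∧ g = a * b := by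
  classical
  let S := Perm.SameCycle.setoid g
  have hr : ∀ x : α, ∃ k : ℤ, (g ^ k) (Quotient.out (Quotient.mk S x)) = x := fun x =>
    Quotient.exact (Quotient.out_eq (Quotient.mk S x))
  choose k hk using hr
  let r : α → α := fun x => Quotient.out (Quotient.mk S x)
  have hrr : ∀ (j : ℤ) (x : α), r ((g ^ j) (r x)) = r x := by
    intro j x
    have : Quotient.mk S ((g ^ j) (r x)) = Quotient.mk S x := by
      rw [← Quotient.out_eq (Quotient.mk S x)]
      apply Quotient.sound
      exact Perm.SameCycle.symm ⟨j, rfl⟩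
    simp only [r] at this ⊢
    rw [this]
  let t : α → α := fun x => (g ^ (-k x)) (r x)
  have ht : ∀ (j : ℤ) (x : α), t ((g ^ j) (r x)) = (g ^ (-j)) (r x) := by
    intro j x
    have h1 := hk ((g ^ j) (r x))
    change (g ^ _) (r _) = _ at h1
    rw [hrr] at h1
    simp only [t]
    rw [hrr]
    generalize k ((g ^ j) (r x)) = l at *
    have h2 : (g ^ (-j - l)) ((g ^ l) (r x)) = (g ^ (-j - l)) ((g ^ j) (r x)) := by rw [h1]
    rw [← Perm.mul_apply, ← Perm.mul_apply, ← zpow_add, ← zpow_add] at h2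
    rw [show -j - l + l = -j by ring, show -j - l + j = -l by ring] at h2
    exact h2.symm
  have htt : ∀ x, t (t x) = x := by
    intro x
    have := ht (-k x) x
    simp only [neg_neg] at this
    exact this.trans (hk x)
  have htg : ∀ x, g (t (g (t x))) = x := by
    intro x
    have e1 : g (t x) = (g ^ (1 - k x)) (r x) := by
      rw [sub_eq_add_neg, zpow_add, zpow_one]; rfl
    rw [e1, ht]
    have : g ((g ^ (-(1 - k x))) (r x)) = (g ^ (1 + -(1 - k x))) (r x) := by
      rw [zpow_add, zpow_one]; rfl
    rw [this, show 1 + -(1 - k x) = k x by ring]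
    exact hk x
  let T : Perm α := ⟨t, t, htt, htt⟩
  have hT : T * T = 1 := Equiv.ext htt
  refine ⟨g * T, T, Equiv.ext htg, hT, ?_⟩
  rw [mul_assoc, hT, mul_one]

theorem exists_generation (p t : ℕ) (hp : p.Prime) (h5 : 5 ≤ p) (ht : p ≤ t) :
    ∃ L : ℕ, ∀ g : Perm (Fin t), Perm.sign g = 1 → g ∈ expSet p (Perm (Fin t)) ^ L := by
  classical
  have : Fact p.Prime := ⟨hp⟩
  have hs : IsSimpleGroup (alternatingGroup (Fin t)) :=
    alternatingGroup.isSimpleGroup (by simp; omega)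
  have : Nontrivial (Fin t) := Fin.nontrivial_iff_two_le.2 (by omega)
  let A := alternatingGroup (Fin t)
  have hn : (Subgroup.normalClosure (expSet p A)) = ⊤ := by
    rcases hs.eq_bot_or_eq_top_of_normal _ (Subgroup.normalClosure_normal (s := expSet p A)) with h | h
    · exfalso
      have hd : p ∣ Nat.card A := by
        have h1 : 2 * Nat.card A = Nat.card (Perm (Fin t)) := two_mul_nat_card_alternatingGroup
        rw [Nat.card_perm, Nat.card_fin] at h1
        have : p ∣ 2 * Nat.card A := by
          rw [h1]; exact (hp.dvd_factorial).2 ht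
        rcases hp.dvd_mul.1 this with h | h
        · have := Nat.le_of_dvd (by norm_num) h; omega
        · exact h
      obtain ⟨x, hx⟩ := exists_prime_orderOf_dvd_card' p hd
      have hxm : x ∈ Subgroup.normalClosure (expSet p A) :=
        Subgroup.subset_normalClosure (by rw [← hx]; exact pow_orderOf_eq_one x)
      rw [h, Subgroup.mem_bot] at hxm
      rw [hxm, orderOf_one] at hx
      omega
    · exact h
  have hall : ∀ g : A, ∃ L, g ∈ expSet p A ^ L := by
    intro g
    have hg : g ∈ Subgroup.normalClosure (expSet p A) := by rw [hn]; trivial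
    unfold Subgroup.normalClosure at hg
    have hc : Group.conjugatesOfSet (expSet p A) ⊆ expSet p A := by
      intro y hy
      rw [Group.mem_conjugatesOfSet_iff] at hy
      obtain ⟨z, hz, hzy⟩ := hy
      obtain ⟨c, rfl⟩ := isConj_iff.1 hzy
      change (c * z * c⁻¹) ^ p = 1
      rw [conj_pow, show z ^ p = 1 from hz]; simp
    induction hg using Subgroup.closure_induction with
    | mem x hx => exact ⟨1, by simpa using hc hx⟩
    | one => exact ⟨0, by simp⟩
    | mul x y _ _ hx hy =>
      obtain ⟨L, hL⟩ := hx
      obtain ⟨M, hM⟩ := hy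
      exact ⟨L + M, by rw [pow_add]; exact Set.mul_mem_mul hL hM⟩
    | inv x _ hx =>
      obtain ⟨L, hL⟩ := hx
      refine ⟨L, ?_⟩
      have : (expSet p A)⁻¹ = expSet p A := by
        ext z; simp [expSet]
      rw [← this, inv_pow]
      simpa using hL
  choose l hl using hall
  refine ⟨Finset.univ.sup l, fun g hg => ?_⟩
  have h1 := expSet_pow_mono p A (Finset.le_sup (f := l) (Finset.mem_univ ⟨g, Perm.mem_alternatingGroup.2 hg⟩)) (hl _)
  exact map_mem_expSet_pow A.subtype _ _ h1

theorem small_support (p t L : ℕ)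
    (hL : ∀ g : Perm (Fin t), Perm.sign g = 1 → g ∈ expSet p (Perm (Fin t)) ^ L)
    {α : Type*} [Fintype α] [DecidableEq α] (ht : t ≤ Fintype.card α) (h : Perm α)
    (hs : Perm.sign h = 1) (hc : h.support.card ≤ t) : h ∈ expSet p (Perm α) ^ L := by
  obtain ⟨Y, hY, hYc⟩ := Finset.exists_superset_card_eq hc ht
  let e : Fin t ≃ {x // x ∈ Y} := (Finset.equivFinOfCardEq hYc).symm
  have hpre : ∀ x, x ∈ Y ↔ h x ∈ Y := by
    intro x
    by_cases hx : h x = x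
    · rw [hx]
    · have h1 : x ∈ h.support := by simpa using hx
      have h2 : h x ∈ h.support := by simpa using hx
      exact ⟨fun _ => hY h2, fun _ => hY h1⟩
  let h0 : Perm {x // x ∈ Y} := h.subtypePerm fun x => (hpre x).symm
  let h1 : Perm (Fin t) := e.symm.permCongr h0
  have hE : Perm.extendDomainHom e h1 = h := by
    ext x
    simp only [Perm.extendDomainHom_apply]
    by_cases hx : x ∈ Y
    · rw [Perm.extendDomain_apply_subtype _ _ hx]
      simp [h1, h0]
    · rw [Perm.extendDomain_apply_not_subtype _ _ hx]
      by_contra hne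
      exact hx (hY (by simpa using fun h => hne h.symm))
  rw [← hE]
  apply map_mem_expSet_pow
  apply hL
  have := Perm.sign_extendDomain h1 e
  rw [← this]
  rw [← hs]
  congr 1

theorem involution_split (p s L : ℕ) (hs4 : 4 ∣ s) (hs0 : 0 < s)
    (hL : ∀ g : Perm (Fin s), Perm.sign g = 1 → g ∈ expSet p (Perm (Fin s)) ^ L)
    {α : Type*} [Fintype α] [DecidableEq α] (a : Perm α) (ha : a * a = 1) :
    ∃ u h : Perm α, a = u * h ∧ u ∈ expSet p (Perm α) ^ L ∧ h.support.card ≤ s := by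
  have : Fact (Nat.Prime 2) := ⟨Nat.prime_two⟩
  have ha2 : a ^ 2 = 1 := by rw [pow_two, ha]
  have hct : ∀ {b : Perm α}, b ^ 2 = 1 → b.cycleType = Multiset.replicate (b.support.card / 2) 2 ∧
      b.support.card % 2 = 0 := by
    intro b hb
    have h1 := Perm.cycleType_of_pow_prime_eq_one hb
    have h2 := b.sum_cycleType
    rw [h1, Multiset.sum_replicate] at h2
    simp only [smul_eq_mul] at h2
    refine ⟨?_, by omega⟩
    rw [← h2]
    simpa using h1
  set N := a.support.card with hN
  have hNeven := (hct ha2).2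
  set r := N / s
  set c := N % s
  have hNrc : s * r + c = N := Nat.div_add_mod N s
  have hcs : c < s := Nat.mod_lt _ hs0
  have hc2 : c % 2 = 0 := by
    obtain ⟨q, hq⟩ := hs4
    have : s * r = 2 * (2 * q * r) := by rw [hq]; ring
    omega
  have hrev : ∀ m : ℕ, m % 2 = 0 → ∀ i : Fin m, Fin.revPerm i ≠ i := by
    intro m hm i h
    have := congrArg Fin.val h
    simp [Fin.val_rev] at this
    omega
  have hrev2 : ∀ m : ℕ, (Fin.revPerm : Perm (Fin m)) * Fin.revPerm = 1 := by
    intro m; ext i; simp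
  let M := (Σ _ : Fin r, Fin s) ⊕ Fin c
  have hM : Fintype.card M = N := by
    simp [M]; rw [mul_comm]; exact hNrc
  let e : M ≃ {x // x ∈ a.support} := Fintype.equivOfCardEq (by rw [hM, Fintype.card_coe])
  let cst : Perm (Fin s) →* (Fin r → Perm (Fin s)) := Pi.constMonoidHom _ _
  let f1 : Perm (Fin s) →* Perm M :=
    (Perm.sumCongrHom _ _).comp ((MonoidHom.inl _ _).comp
      ((Perm.sigmaCongrRightHom (fun _ : Fin r => Fin s)).comp cst))
  let f2 : Perm (Fin c) →* Perm M :=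
    (Perm.sumCongrHom _ _).comp (MonoidHom.inr _ _)
  let E := Perm.extendDomainHom e
  let m0 : Perm M := f1 Fin.revPerm * f2 Fin.revPerm
  have hm0l : ∀ i j, m0 (Sum.inl ⟨i, j⟩) = Sum.inl ⟨i, Fin.revPerm j⟩ := fun i j => rfl
  have hm0r : ∀ j, m0 (Sum.inr j) = Sum.inr (Fin.revPerm j) := fun j => rfl
  have hm2 : m0 ^ 2 = 1 := by
    rw [pow_two]
    ext x
    rcases x with ⟨i, j⟩ | j
    · rw [Perm.mul_apply, hm0l, hm0l]; simp
    · rw [Perm.mul_apply, hm0r, hm0r]; simp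
  have hsupp : m0.support = Finset.univ := by
    ext x
    simp only [Perm.mem_support, Finset.mem_univ, iff_true]
    rcases x with ⟨i, j⟩ | j
    · rw [hm0l]
      intro h
      have h' := hrev s (by omega) j
      have h2 := Sum.inl_injective h
      simp only [Sigma.mk.injEq, heq_eq_eq, true_and] at h2
      exact h' h2
    · rw [hm0r]
      intro h
      exact hrev c hc2 j (Sum.inr_injective h)
  have hEm : (E m0).support.card = N := by
    have : (E m0).support.card = m0.support.card := Perm.card_support_extend_domain e
    rw [this, hsupp, Finset.card_univ, hM]
  have hconj : IsConj (E m0) a := by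
    rw [Perm.isConj_iff_cycleType_eq, (hct ha2).1, (hct (b := E m0) (by rw [← map_pow, hm2, map_one])).1,
      hEm]
  obtain ⟨w, hw⟩ := isConj_iff.1 hconj
  refine ⟨w * E (f1 Fin.revPerm) * w⁻¹, w * E (f2 Fin.revPerm) * w⁻¹, ?_, ?_, ?_⟩
  · rw [← hw]; simp only [m0, map_mul]; group
  · have := map_mem_expSet_pow ((MulAut.conj w).toMonoidHom.comp (E.comp f1)) L (Fin.revPerm) (hL _ ?_)
    · exact this
    · have h1 : (Fin.revPerm : Perm (Fin s)) ^ 2 = 1 := by rw [pow_two, hrev2]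
      have h2 := Perm.cycleType_of_pow_prime_eq_one h1
      have h3 : (Fin.revPerm : Perm (Fin s)).support = Finset.univ := by
        ext x
        simp only [Perm.mem_support, Finset.mem_univ, iff_true]
        exact hrev s (by omega) x
      have h4 := (Fin.revPerm : Perm (Fin s)).sum_cycleType
      rw [h3, h2, Multiset.sum_replicate] at h4
      simp only [smul_eq_mul, Finset.card_univ, Fintype.card_fin] at h4
      rw [Perm.sign_of_cycleType', h2, Multiset.map_replicate, Multiset.prod_replicate]
      have : Even (Fin.revPerm : Perm (Fin s)).cycleType.card := by
        rw [Nat.even_iff]; omega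
      simp [this.neg_one_pow]
  · rw [Perm.card_support_conj]
    have : (E (f2 Fin.revPerm)).support.card = (f2 Fin.revPerm).support.card :=
      Perm.card_support_extend_domain e
    rw [this]
    have hsub : (f2 Fin.revPerm).support ⊆ (Finset.univ : Finset (Fin c)).image Sum.inr := by
      intro x hx
      rcases x with x | x
      · exfalso
        rw [Perm.mem_support] at hx
        exact hx rfl
      · simp
    calc _ ≤ _ := Finset.card_le_card hsub
      _ ≤ _ := Finset.card_image_le
      _ ≤ s := by simp; omega

theorem sign_of_mem_expSet_pow {p : ℕ} (hp : p % 2 = 1) {α : Type*} [Fintype α] [DecidableEq α]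
    (L : ℕ) (x : Perm α) (hx : x ∈ expSet p (Perm α) ^ L) : Perm.sign x = 1 := by
  refine map_eq_one_of_mem_expSet_pow (F := ℤˣ) ?_ Perm.sign L x hx
  have : Nat.card ℤˣ = 2 := by simp
  rw [this, Nat.coprime_two_right]
  exact Nat.odd_iff.2 hp

theorem bounded_width (p : ℕ) (hp : p.Prime) (h5 : 5 ≤ p) :
    ∃ B L : ℕ, ∀ n, B ≤ n → ∀ g : alternatingGroup (Fin n),
      g ∈ expSet p (alternatingGroup (Fin n)) ^ L := by
  have hodd : p % 2 = 1 := by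
    rcases hp.eq_two_or_odd with h | h <;> omega
  obtain ⟨L1, hL1⟩ := exists_generation p (4 * p) hp h5 (by omega)
  obtain ⟨L2, hL2⟩ := exists_generation p (8 * p) hp h5 (by omega)
  refine ⟨8 * p, L1 + L1 + L2, fun n hn g => ?_⟩
  have key : (g : Perm (Fin n)) ∈ expSet p (Perm (Fin n)) ^ (L1 + L1 + L2) := by
    obtain ⟨a, b, ha, hb, hab⟩ := exists_involutions (g : Perm (Fin n))
    obtain ⟨u, h, rfl, hu, hh⟩ := involution_split p (4 * p) L1 (by simp) (by omega) hL1 a ha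
    obtain ⟨v, k, rfl, hv, hk⟩ := involution_split p (4 * p) L1 (by simp) (by omega) hL1 b hb
    have hv' : h * v * h⁻¹ ∈ expSet p (Perm (Fin n)) ^ L1 :=
      map_mem_expSet_pow (MulAut.conj h).toMonoidHom L1 v hv
    have e : (g : Perm (Fin n)) = u * (h * v * h⁻¹) * (h * k) := by rw [hab]; group
    have hsg : Perm.sign (g : Perm (Fin n)) = 1 := Perm.mem_alternatingGroup.1 g.2
    have hsk : Perm.sign (h * k) = 1 := by
      rw [e, map_mul, map_mul, sign_of_mem_expSet_pow hodd L1 _ hu,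
        sign_of_mem_expSet_pow hodd L1 _ hv', one_mul, one_mul] at hsg
      exact hsg
    rw [e, pow_add, pow_add]
    refine Set.mul_mem_mul (Set.mul_mem_mul hu hv') ?_
    refine small_support p (8 * p) L2 hL2 (by simpa using hn) _ hsk ?_
    calc _ ≤ (h.support ∪ k.support).card := Finset.card_le_card (Perm.support_mul_le h k)
      _ ≤ _ := Finset.card_union_le _ _
      _ ≤ _ := by omega
  have himg : expSet p (Perm (Fin n)) = (alternatingGroup (Fin n)).subtype '' expSet p _ := by
    ext x
    constructor
    · intro hx
      refine ⟨⟨x, Perm.mem_alternatingGroup.2 (sign_of_mem_expSet_pow hodd 1 x (by simpa using hx))⟩,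
        Subtype.ext hx, rfl⟩
    · rintro ⟨y, hy, rfl⟩
      exact congrArg Subtype.val hy
  rw [himg, ← Set.image_pow] at key
  obtain ⟨y, hy, hyg⟩ := key
  rwa [← Subtype.ext hyg]

theorem hom_trivial {n : ℕ} (hn : 5 ≤ n) {X : Type*} [Finite X] (hX : Nat.card X < n)
    (f : alternatingGroup (Fin n) →* Perm X) (x : alternatingGroup (Fin n)) : f x = 1 := by
  have hs : IsSimpleGroup (alternatingGroup (Fin n)) :=
    alternatingGroup.isSimpleGroup (by simp; omega)
  have : Nontrivial (Fin n) := Fin.nontrivial_iff_two_le.2 (by omega)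
  rcases hs.eq_bot_or_eq_top_of_normal _ f.normal_ker with h | h
  · exfalso
    have hi := (MonoidHom.ker_eq_bot_iff f).1 h
    have h1 := Nat.card_le_card_of_injective f hi
    have h2 : 2 * Nat.card (alternatingGroup (Fin n)) = Nat.card (Perm (Fin n)) :=
      two_mul_nat_card_alternatingGroup
    rw [Nat.card_perm] at h1
    rw [Nat.card_perm, Nat.card_fin] at h2
    obtain ⟨m, rfl⟩ : ∃ m, n = m + 1 := ⟨n - 1, by omega⟩
    have h3 : (Nat.card X).factorial ≤ m.factorial := Nat.factorial_le (by omega)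
    rw [Nat.factorial_succ] at h2
    have := Nat.factorial_pos m
    nlinarith
  · have : x ∈ f.ker := by rw [h]; trivial
    exact this

theorem kerFirstCoords_le (n : ℕ → ℕ) (hn : StrictMono n) (h5 : 5 ≤ n 0) (k : ℕ)
    {F : Type*} [Finite F] (hF : Nat.card F < n k)
    (f : (∀ i : ℕ, alternatingGroup (Fin (n i))) →* Perm F)
    (g : ∀ i : ℕ, alternatingGroup (Fin (n i))) (hg : ∀ i < k, g i = 1) : f g = 1 := by
  classical
  have h5' : ∀ i, 5 ≤ n i := fun i => h5.trans (hn.monotone (Nat.zero_le i))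
  obtain ⟨p, hpn, hp⟩ := Nat.exists_infinite_primes (n k)
  obtain ⟨B, L, hB⟩ := bounded_width p hp ((h5' k).trans hpn)
  have key : ∀ b : ℕ, ∀ g : ∀ i : ℕ, alternatingGroup (Fin (n i)), (∀ i < k, g i = 1) →
      (∀ i, b ≤ i → g i = 1) → f g = 1 := by
    intro b
    induction b with
    | zero =>
      intro g _ h
      rw [show g = 1 from funext fun i => h i (Nat.zero_le i), map_one]
    | succ b ih =>
      intro g h1 h2
      have e : g = Function.update g b 1 * Pi.mulSingle b (g b) := by
        ext1 i
        by_cases hi : i = b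
        · subst hi; simp
        · simp [hi]
      rw [e, map_mul, ih, one_mul]
      · by_cases hb : b < k
        · rw [h1 b hb]; simp
        · exact hom_trivial (h5' b) (hF.trans_le (hn.monotone (by omega)))
            (f.comp (MonoidHom.mulSingle (fun i => alternatingGroup (Fin (n i))) b)) (g b)
      · intro i hi
        by_cases hib : i = b
        · subst hib; simp
        · simp [hib, h1 i hi]
      · intro i hi
        by_cases hib : i = b
        · subst hib; simp
        · simp [hib, h2 i (by omega)]
  have e : g = (fun i => if i < B then g i else 1) * (fun i => if i < B then 1 else g i) := by
    ext1 i
    by_cases hi : i < B <;> simp [hi]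
  rw [e, map_mul, key B, one_mul]
  · refine map_eq_one_of_mem_expSet_pow (p := p) ?_ f L _ (pi_mem_expSet_pow L _ fun i => ?_)
    · rw [Nat.card_perm, Nat.coprime_factorial_iff hp.ne_one]
      rw [hp.minFac_eq]
      omega
    · by_cases hi : i < B
      · simp only [hi, if_true]
        exact Set.one_mem_pow (one_mem_expSet p _)
      · simp only [hi, if_false]
        exact hB _ ((by omega : B ≤ i).trans hn.le_apply) _
  · intro i hi
    simp [hg i hi]
  · intro i hi
    simp [not_lt.2 hi]

theorem interLambda_eq (n : ℕ → ℕ) (hn : StrictMono n) (h5 : 5 ≤ n 0) (k : ℕ) :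
    interLambda (∀ i : ℕ, alternatingGroup (Fin (n i))) (n k - 1) = kerFirstCoords k := by
  have h5' : ∀ i, 5 ≤ n i := fun i => h5.trans (hn.monotone (Nat.zero_le i))
  apply le_antisymm
  · intro g hg i hi
    unfold interLambda at hg
    simp only [Subgroup.mem_iInf] at hg
    apply Subtype.ext
    ext1 j
    let ψ : (∀ i : ℕ, alternatingGroup (Fin (n i))) →* Perm (Fin (n i)) :=
      (alternatingGroup (Fin (n i))).subtype.comp
        (Pi.evalMonoidHom (fun i => alternatingGroup (Fin (n i))) i)
    letI : MulAction (∀ i : ℕ, alternatingGroup (Fin (n i))) (Fin (n i)) :=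
      MulAction.compHom (Fin (n i)) ψ
    have hmem := hg (MulAction.stabilizer (∀ i : ℕ, alternatingGroup (Fin (n i))) j) (by
      rw [MulAction.index_stabilizer]
      constructor
      · have : (MulAction.orbit (∀ i : ℕ, alternatingGroup (Fin (n i))) j).Nonempty :=
          ⟨j, MulAction.mem_orbit_self j⟩
        exact ((Set.ncard_pos (Set.toFinite _)).2 this).ne'
      · have h1 := Set.ncard_le_card (MulAction.orbit (∀ i : ℕ, alternatingGroup (Fin (n i))) j)
        rw [Nat.card_fin] at h1
        have := hn hi
        omega)
    exact hmem
  · intro g hg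
    unfold interLambda
    simp only [Subgroup.mem_iInf]
    rintro H ⟨h0, hle⟩
    have : Finite ((∀ i : ℕ, alternatingGroup (Fin (n i))) ⧸ H) := Nat.finite_of_card_ne_zero h0
    have h1 := kerFirstCoords_le n hn h5 k
      (F := (∀ i : ℕ, alternatingGroup (Fin (n i))) ⧸ H) (by
        have := h5' k
        change H.index < n k
        omega)
      (MulAction.toPermHom _ _) g hg
    have h2 : g ∈ H.normalCore := by
      rw [Subgroup.normalCore_eq_ker]; exact h1
    exact H.normalCore_le h2

theorem index_kerFirstCoords {G : ℕ → Type*} [∀ i, Group (G i)] (k : ℕ) :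
    (kerFirstCoords k : Subgroup (∀ i, G i)).index = ∏ i ∈ Finset.range k, Nat.card (G i) := by
  classical
  let f : (∀ i, G i) →* (∀ i : Fin k, G i) :=
    { toFun := fun g i => g i
      map_one' := rfl
      map_mul' := fun _ _ => rfl }
  have hk : (kerFirstCoords k : Subgroup (∀ i, G i)) = f.ker := by
    ext g
    constructor
    · intro h
      exact funext fun i => h i i.2
    · intro h i hi
      exact congrFun (show f g = 1 from h) ⟨i, hi⟩
  have hf : Function.Surjective f := by
    intro y
    refine ⟨fun i => if h : i < k then y ⟨i, h⟩ else 1, ?_⟩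
    funext i
    simp [f]
  rw [hk, Subgroup.index_ker, MonoidHom.range_eq_top.2 hf, Subgroup.card_top, Nat.card_pi,
    Finset.prod_range]

theorem interLambda_le_kerFirstCoords_and_growth_lower_bound
    (n : ℕ → ℕ) (hn : StrictMono n) (h5 : 5 ≤ n 0) (k : ℕ) :
    interLambda (∀ i : ℕ, alternatingGroup (Fin (n i))) (n k - 1) ≤ kerFirstCoords k ∧
    (∏ i ∈ Finset.range k, Nat.card (alternatingGroup (Fin (n i)))) ≤
      interGrowth (∀ i : ℕ, alternatingGroup (Fin (n i))) (n k - 1) := by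
  refine ⟨(interLambda_eq n hn h5 k).le, ?_⟩
  rw [interGrowth, interLambda_eq n hn h5 k, index_kerFirstCoords]
end

section
/- Let n : ℕ → ℕ be strictly increasing with n 0 ≥ 5, and let G = Π i, alternatingGroup (Fin (n i)). Then for every k : ℕ, the intersection growth of G at n k − 1 satisfies i_G(n k − 1) = ∏_{i < k} Nat.card (alternatingGroup (Fin (n i))). -/
open Equiv Equiv.Perm Pointwise

namespace InterGrowthAux

/-- Every permutation is a product of two involutions. -/
theorem exists_two_involutions {α : Type*} (g : Perm α) :
    ∃ u v : Perm α, u ^ 2 = 1 ∧ v ^ 2 = 1 ∧ g = u * v := by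
  classical
  let r : α → α := fun y => (Quotient.mk (SameCycle.setoid g) y).out
  have hr : ∀ y, SameCycle g (r y) y := fun y => Quotient.exact (Quotient.out_eq (Quotient.mk (SameCycle.setoid g) y))
  have hr2 : ∀ y z, SameCycle g y z → r y = r z := by
    intro y z h
    have : Quotient.mk (SameCycle.setoid g) y = Quotient.mk (SameCycle.setoid g) z := Quotient.sound h
    simp only [r, this]
  choose c hc using hr
  let v : α → α := fun y => (g ^ (-(c y))) (r y)
  have key : ∀ (y : α) (k : ℤ), v ((g ^ k) (r y)) = (g ^ (-k)) (r y) := by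
    intro y k
    have h1 : r ((g ^ k) (r y)) = r y := by
      apply hr2
      exact SameCycle.trans (SameCycle.symm ⟨k, rfl⟩) ⟨c y, hc y⟩
    have h2 := hc ((g ^ k) (r y))
    simp only [v]
    rw [h1] at h2 ⊢
    set d := c ((g ^ k) (r y))
    have h3 : (g ^ (-d - k)) ((g ^ d) (r y)) = (g ^ (-d - k)) ((g ^ k) (r y)) := by rw [h2]
    rw [← Perm.mul_apply, ← Perm.mul_apply, ← zpow_add, ← zpow_add] at h3
    rw [show -d - k + d = -k by ring, show -d - k + k = -d by ring] at h3
    exact h3.symm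
  have hv : Function.Involutive v := by
    intro y
    show v ((g ^ (-(c y))) (r y)) = y
    rw [key, neg_neg, hc]
  have hgv : ∀ y, g (v (g (v y))) = y := by
    intro y
    have : g (v y) = (g ^ (1 - c y)) (r y) := by
      simp only [v]
      rw [sub_eq_add_neg, zpow_add, zpow_one, Perm.mul_apply]
    rw [this, key]
    have : g ((g ^ (-(1 - c y))) (r y)) = (g ^ (1 + -(1 - c y))) (r y) := by
      rw [zpow_add, zpow_one, Perm.mul_apply]
    rw [this, show 1 + -(1 - c y) = c y by ring, hc]
  let V : Perm α := hv.toPerm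
  have hV : V ^ 2 = 1 := by
    ext y; simp [pow_two, V, hv y]
  refine ⟨g * V, V, ?_, hV, ?_⟩
  · ext y; simpa [pow_two, V] using hgv y
  · rw [mul_assoc, ← pow_two, hV, mul_one]

set_option linter.unusedSectionVars false

variable {α : Type*} [Fintype α] [DecidableEq α]

theorem swap_split (w : Perm α) (hw : w ^ 2 = 1) (x : α) (hx : w x ≠ x) :
    ∃ w' : Perm α, w' ^ 2 = 1 ∧ Perm.Disjoint (swap x (w x)) w' ∧ w = swap x (w x) * w' := by
  have hwx : ∀ y, w (w y) = y := fun y => by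
    have := congrArg (fun f : Perm α => f y) hw
    simpa [pow_two] using this
  have hd : Perm.Disjoint (swap x (w x)) (swap x (w x) * w) := by
    intro y
    by_cases h1 : y = x
    · right; subst h1; simp
    by_cases h2 : y = w x
    · right; subst h2; simp [hwx]
    left
    exact swap_apply_of_ne_of_ne h1 h2
  have hm : w = swap x (w x) * (swap x (w x) * w) := by
    rw [← mul_assoc, swap_mul_self, one_mul]
  refine ⟨swap x (w x) * w, ?_, hd, hm⟩
  have := hd.commute.mul_pow 2
  rw [← hm, hw, pow_two (swap _ _), swap_mul_self, one_mul] at this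
  exact this.symm

theorem inv_split (s : ℕ) : ∀ w : Perm α, w ^ 2 = 1 → 2 * s ≤ w.support.card →
    ∃ w1 w2 : Perm α, w1 ^ 2 = 1 ∧ w2 ^ 2 = 1 ∧ Perm.Disjoint w1 w2 ∧ w = w1 * w2 ∧
      w1.support.card = 2 * s := by
  induction s with
  | zero => intro w hw _; exact ⟨1, w, by simp, hw, disjoint_one_left w, by simp, by simp⟩
  | succ s ih =>
    intro w hw hs
    have : w.support.Nonempty := by
      rw [← Finset.card_pos]; omega
    obtain ⟨x, hx⟩ := this
    rw [mem_support] at hx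
    obtain ⟨w', hw', hd, hm⟩ := swap_split w hw x hx
    have h2 : (swap x (w x)).support.card = 2 := card_support_swap hx.symm
    have hc := hd.card_support_mul
    rw [← hm, h2] at hc
    obtain ⟨a, b, ha, hb, hab, hw'ab, hac⟩ := ih w' hw' (by omega)
    have hdd := hd.disjoint_support
    rw [hw'ab, hab.support_mul] at hdd
    have hta : Perm.Disjoint (swap x (w x)) a := disjoint_iff_disjoint_support.2 (hdd.mono_right Finset.subset_union_left)
    have htb : Perm.Disjoint (swap x (w x)) b := disjoint_iff_disjoint_support.2 (hdd.mono_right Finset.subset_union_right)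
    refine ⟨swap x (w x) * a, b, ?_, hb, htb.mul_left hab, ?_, ?_⟩
    · rw [hta.commute.mul_pow, ha, pow_two, swap_mul_self, one_mul]
    · rw [mul_assoc, ← hw'ab]; exact hm
    · rw [hta.card_support_mul, h2, hac]; ring

theorem sign_inv {w : Perm α} (hw : w ^ 2 = 1) : sign w = (-1) ^ (w.support.card / 2) := by
  rw [sign_of_pow_two_eq_one hw]
  congr 2
  have h := w.card_fixedPoints
  rw [sum_cycleType] at h
  have := Finset.card_le_univ w.support
  omega

/-- the set of small even involutions -/
def small (α : Type*) [Fintype α] [DecidableEq α] (N : ℕ) : Set (Perm α) :=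
  {w | w ^ 2 = 1 ∧ ∃ j, w.support.card = 4 * j ∧ j * N ≤ Fintype.card α}

theorem one_mem_small (N : ℕ) : (1 : Perm α) ∈ small α N := ⟨by simp, 0, by simp, by simp⟩

theorem even_inv_aux {N q : ℕ} (hq : q * N ≤ Fintype.card α) (L : ℕ) :
    ∀ w : Perm α, w ^ 2 = 1 → 4 ∣ w.support.card → w.support.card ≤ 4 * (q * L) →
      w ∈ small α N ^ L := by
  induction L with
  | zero =>
    intro w hw _ h
    simp at h
    simp [h]
  | succ L ih =>
    intro w hw h4 h
    obtain ⟨t, ht⟩ := h4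
    rcases le_total t q with htq | htq
    · have : w ∈ small α N := ⟨hw, t, ht, le_trans (Nat.mul_le_mul_right _ htq) hq⟩
      have := Set.pow_subset_pow_right (one_mem_small (α := α) N) (show 1 ≤ L + 1 by omega) (by simpa using this)
      exact this
    · obtain ⟨a, b, ha, hb, hab, hw', hac⟩ := inv_split (2 * q) w hw (by omega)
      have hc := hab.card_support_mul
      rw [← hw', hac, ht] at hc
      have hb' : b ∈ small α N ^ L := by
        apply ih b hb
        · exact ⟨t - q, by omega⟩
        · rw [ht] at h; nlinarith
      rw [pow_succ', hw']
      exact Set.mul_mem_mul ⟨ha, q, by omega, hq⟩ hb'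

theorem even_inv {N : ℕ} (hN : 0 < N) (hc : N ≤ Fintype.card α) {w : Perm α} (hw : w ^ 2 = 1)
    (hs : sign w = 1) : w ∈ small α N ^ N := by
  apply even_inv_aux (q := Fintype.card α / N) (Nat.div_mul_le_self _ _) N w hw
  · rw [sign_inv hw] at hs
    have h2 := two_dvd_card_support hw
    rcases Nat.even_or_odd (w.support.card / 2) with h | h
    · obtain ⟨r, hr⟩ := h; exact ⟨r, by omega⟩
    · rw [h.neg_one_pow] at hs; exact absurd hs (by decide)
  · have h1 := Finset.card_le_univ w.support
    have h2 := Nat.div_add_mod (Fintype.card α) N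
    have h3 := Nat.mod_lt (Fintype.card α) hN
    have h4 : 1 ≤ Fintype.card α / N := Nat.div_pos hc hN
    nlinarith

theorem swap_inv (x y : α) : (swap x y) ^ 2 = 1 := by rw [pow_two, swap_mul_self]

theorem two_swaps {N : ℕ} (h5 : 5 ≤ N) (hc : N ≤ Fintype.card α) {x y z t : α} (hxy : x ≠ y)
    (hzt : z ≠ t) : swap x y * swap z t ∈ small α N ^ N * small α N ^ N := by
  have h1 : (1 : Perm α) ∈ small α N ^ N := even_inv (by omega) hc (by simp) (by simp)
  by_cases hcomm : Commute (swap x y) (swap z t)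
  · refine ⟨swap x y * swap z t, ?_, 1, h1, by simp⟩
    apply even_inv (by omega) hc
    · rw [hcomm.mul_pow, swap_inv, swap_inv, one_mul]
    · simp [sign_swap hxy, sign_swap hzt]
  · have hcard : ((swap x y).support ∪ (swap z t).support).card ≤ 3 := by
      have hnd : ¬ _root_.Disjoint (swap x y).support (swap z t).support := fun h =>
        hcomm (disjoint_iff_disjoint_support.2 h).commute
      rw [Finset.disjoint_iff_inter_eq_empty, ← Finset.card_eq_zero] at hnd
      have := Finset.card_union_add_card_inter (swap x y).support (swap z t).support
      rw [card_support_swap hxy, card_support_swap hzt] at this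
      omega
    have : 1 < ((swap x y).support ∪ (swap z t).support)ᶜ.card := by
      rw [Finset.card_compl]; omega
    obtain ⟨p, hp, q, hq, hpq⟩ := Finset.one_lt_card.1 this
    have hd : _root_.Disjoint ((swap x y).support ∪ (swap z t).support) (swap p q).support := by
      rw [Finset.disjoint_left]
      intro a ha hb
      rw [support_swap hpq, Finset.mem_insert, Finset.mem_singleton] at hb
      rw [Finset.mem_compl] at hp hq
      rcases hb with rfl | rfl <;> contradiction
    have d1 : Perm.Disjoint (swap x y) (swap p q) := disjoint_iff_disjoint_support.2 (hd.mono_left Finset.subset_union_left)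
    have d2 : Perm.Disjoint (swap z t) (swap p q) := disjoint_iff_disjoint_support.2 (hd.mono_left Finset.subset_union_right)
    refine ⟨swap x y * swap p q, ?_, swap p q * swap z t, ?_, ?_⟩
    · apply even_inv (by omega) hc
      · rw [d1.commute.mul_pow, swap_inv, swap_inv, one_mul]
      · simp [sign_swap hxy, sign_swap hpq]
    · apply even_inv (by omega) hc
      · rw [d2.symm.commute.mul_pow, swap_inv, swap_inv, one_mul]
      · simp [sign_swap hpq, sign_swap hzt]
    · simp only
      rw [mul_assoc, ← mul_assoc (swap p q), swap_mul_self, one_mul]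

theorem even_mem {N : ℕ} (h5 : 5 ≤ N) (hc : N ≤ Fintype.card α) {g : Perm α} (hg : sign g = 1) :
    g ∈ small α N ^ (4 * N) := by
  have hpow : small α N ^ (4 * N) =
      small α N ^ N * (small α N ^ N * small α N ^ N) * small α N ^ N := by
    rw [← pow_add, ← pow_add, ← pow_add]; congr 1; ring
  have h1 : (1 : Perm α) ∈ small α N ^ N := even_inv (by omega) hc (by simp) (by simp)
  rw [hpow]
  obtain ⟨u, v, hu, hv, rfl⟩ := exists_two_involutions g
  rw [Perm.sign_mul] at hg
  rcases Int.units_eq_one_or (sign u) with hsu | hsu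
  · have hsv : sign v = 1 := by simpa [hsu] using hg
    have := Set.mul_mem_mul (Set.mul_mem_mul (even_inv (by omega) hc hu hsu)
      (Set.mul_mem_mul h1 h1)) (even_inv (by omega) hc hv hsv)
    simpa using this
  · have hsv : sign v = -1 := by
      rw [hsu] at hg
      rcases Int.units_eq_one_or (sign v) with h | h
      · rw [h] at hg; exact absurd hg (by decide)
      · exact h
    have ex : ∀ w : Perm α, sign w = -1 → ∃ x, w x ≠ x := by
      intro w hw
      by_contra! h
      have : w = 1 := by ext x; simp [h x]
      rw [this, Perm.sign_one] at hw
      exact absurd hw (by decide)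
    obtain ⟨x, hx⟩ := ex u hsu
    obtain ⟨y, hy⟩ := ex v hsv
    obtain ⟨u', hu', hdu, hmu⟩ := swap_split u hu x hx
    obtain ⟨v', hv', hdv, hmv⟩ := swap_split v hv y hy
    have su : sign u' = 1 := by
      rw [hmu, Perm.sign_mul, sign_swap hx.symm] at hsu; simpa using hsu
    have sv : sign v' = 1 := by
      rw [hmv, Perm.sign_mul, sign_swap hy.symm] at hsv; simpa using hsv
    have := Set.mul_mem_mul (Set.mul_mem_mul (even_inv (by omega) hc hu' su)
      (two_swaps h5 hc hx.symm hy.symm)) (even_inv (by omega) hc hv' sv)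
    convert this using 1
    rw [← mul_assoc u', ← hdu.commute.eq, ← hmu, mul_assoc, ← hmv]

/-- A homomorphism from `A_N` to a smaller finite group is trivial. -/
theorem hom_trivial {N : ℕ} (h5 : 5 ≤ N) {Q : Type*} [Group Q] [Finite Q]
    (hQ : Nat.card Q < Nat.card (alternatingGroup (Fin N)))
    (f : alternatingGroup (Fin N) →* Q) (x : alternatingGroup (Fin N)) : f x = 1 := by
  have : IsSimpleGroup (alternatingGroup (Fin N)) := alternatingGroup.isSimpleGroup (by simpa using h5)
  rcases (inferInstance : f.ker.Normal).eq_bot_or_eq_top with h | h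
  · rw [MonoidHom.ker_eq_bot_iff] at h
    exact absurd (Nat.card_le_card_of_injective f h) (by omega)
  · rw [← MonoidHom.mem_ker, h]; trivial

theorem two_mul_card_alt {N : ℕ} (h5 : 5 ≤ N) :
    2 * Nat.card (alternatingGroup (Fin N)) = N.factorial := by
  have : Nontrivial (Fin N) := Fin.nontrivial_iff_two_le.2 (by omega)
  rw [two_mul_nat_card_alternatingGroup, Nat.card_perm, Nat.card_fin]

theorem factorial_lt_card_alt {N m : ℕ} (h5 : 5 ≤ N) (hm : m ≤ N - 1) :
    m.factorial < Nat.card (alternatingGroup (Fin N)) := by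
  have h := two_mul_card_alt h5
  have h1 := Nat.factorial_le hm
  have h2 : N.factorial = N * (N - 1).factorial := (Nat.mul_factorial_pred (by omega)).symm
  have h3 := Nat.factorial_pos (N - 1)
  nlinarith

/-- The diagonal action of `Perm β` on `γ × β`. -/
def diagHom (γ β : Type*) : Perm β →* Perm (γ × β) where
  toFun σ := prodCongrRight fun _ => σ
  map_one' := by ext <;> simp
  map_mul' := by intros; ext <;> simp

/-- The base double transposition. -/
def base (N : ℕ) (h5 : 5 ≤ N) : alternatingGroup (Fin N) :=
  ⟨swap ⟨0, by omega⟩ ⟨1, by omega⟩ * swap ⟨2, by omega⟩ ⟨3, by omega⟩, by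
    have h1 : (⟨0, by omega⟩ : Fin N) ≠ ⟨1, by omega⟩ := by simp
    have h2 : (⟨2, by omega⟩ : Fin N) ≠ ⟨3, by omega⟩ := by simp
    rw [mem_alternatingGroup, Perm.sign_mul, sign_swap h1, sign_swap h2]; decide⟩

theorem base_disj (N : ℕ) (h5 : 5 ≤ N) :
    Perm.Disjoint (swap (⟨0, by omega⟩ : Fin N) ⟨1, by omega⟩) (swap ⟨2, by omega⟩ ⟨3, by omega⟩) := by
  rw [disjoint_iff_disjoint_support, support_swap (by simp), support_swap (by simp)]
  simp

theorem base_sq (N : ℕ) (h5 : 5 ≤ N) : (base N h5 : Perm (Fin N)) ^ 2 = 1 := by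
  simp only [base]
  rw [(base_disj N h5).commute.mul_pow, swap_inv, swap_inv, one_mul]

theorem base_card (N : ℕ) (h5 : 5 ≤ N) : (base N h5 : Perm (Fin N)).support.card = 4 := by
  simp only [base]
  rw [(base_disj N h5).card_support_mul, card_support_swap (by simp), card_support_swap (by simp)]

theorem card_support_diag {γ β δ : Type*} [Fintype γ] [Fintype β] [DecidableEq γ] [DecidableEq β]
    [Fintype δ] [DecidableEq δ]
    (e : γ × β ↪ δ) (σ : Perm β) :
    (viaEmbeddingHom e (diagHom γ β σ)).support.card = Fintype.card γ * σ.support.card := by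
  have : (viaEmbeddingHom e (diagHom γ β σ)).support
      = ((Finset.univ : Finset γ) ×ˢ σ.support).map e := by
    ext y
    rw [viaEmbeddingHom_apply]
    by_cases hy : y ∈ Set.range e
    · obtain ⟨⟨a, b⟩, rfl⟩ := hy
      rw [mem_support, viaEmbedding_apply]
      simp [diagHom]
    · rw [mem_support, viaEmbedding_apply_of_notMem _ _ _ hy]
      simp only [ne_eq, not_true_eq_false, false_iff, Finset.mem_map, not_exists, not_and]
      intro x _ h
      exact hy ⟨x, h⟩
  rw [this, Finset.card_map, Finset.card_product, Finset.card_univ]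

theorem small_hom {N : ℕ} (h5 : 5 ≤ N) {w : Perm α} (hw : w ∈ small α N) :
    ∃ f : alternatingGroup (Fin N) →* alternatingGroup α, (f (base N h5) : Perm α) = w := by
  obtain ⟨hw2, j, hj, hjN⟩ := hw
  obtain ⟨e⟩ : Nonempty (Fin j × Fin N ↪ α) :=
    Function.Embedding.nonempty_of_card_le (by simpa using hjN)
  let F : Perm (Fin N) →* Perm α := (viaEmbeddingHom e).comp (diagHom (Fin j) (Fin N))
  have hF2 : (F (base N h5)) ^ 2 = 1 := by rw [← map_pow, base_sq, map_one]
  have hFc : (F (base N h5)).support.card = 4 * j := by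
    simp only [F, MonoidHom.comp_apply]
    rw [card_support_diag, base_card, Fintype.card_fin, mul_comm]
  have hconj : IsConj (F (base N h5)) w := by
    rw [isConj_iff_cycleType_eq]
    have e1 := cycleType_of_pow_prime_eq_one (p := 2) hF2
    have e2 := cycleType_of_pow_prime_eq_one (p := 2) hw2
    have s1 := sum_cycleType (F (base N h5))
    have s2 := sum_cycleType w
    rw [e1, Multiset.sum_replicate, hFc, smul_eq_mul] at s1
    rw [e2, Multiset.sum_replicate, hj, smul_eq_mul] at s2
    rw [e1, e2]
    congr 1
    omega
  obtain ⟨c, hc⟩ := isConj_iff.1 hconj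
  let F' : alternatingGroup (Fin N) →* Perm α :=
    ((MulAut.conj c).toMonoidHom.comp F).comp (alternatingGroup (Fin N)).subtype
  have hF' : ∀ x, F' x ∈ alternatingGroup α := by
    intro x
    rw [mem_alternatingGroup]
    refine hom_trivial h5 ?_ ((sign : Perm α →* ℤˣ).comp F') x
    have := factorial_lt_card_alt h5 (m := 2) (by omega)
    simpa using this
  refine ⟨F'.codRestrict _ hF', ?_⟩
  simpa [F'] using hc

theorem mem_pow_good {N : ℕ} (h5 : 5 ≤ N) (hc : N ≤ Fintype.card α) (g : alternatingGroup α) :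
    g ∈ {x | ∃ f : alternatingGroup (Fin N) →* alternatingGroup α, f (base N h5) = x} ^ (4 * N) := by
  have h := even_mem h5 hc (mem_alternatingGroup.1 g.2)
  have hsub : small α N ⊆ (alternatingGroup α).subtype ''
      {x | ∃ f : alternatingGroup (Fin N) →* alternatingGroup α, f (base N h5) = x} := by
    intro w hw
    obtain ⟨f, hf⟩ := small_hom h5 hw
    exact ⟨f (base N h5), ⟨f, rfl⟩, hf⟩
  have h' := Set.pow_subset_pow_left hsub h
  rw [← Set.image_pow] at h'
  obtain ⟨y, hy, hyg⟩ := h'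
  have : y = g := Subtype.ext hyg
  rwa [this] at hy

theorem prod_trivial {ι : Type*} {A : ι → Type*} [∀ i, Group (A i)] {N : ℕ} (h5 : 5 ≤ N)
    {Q : Type*} [Group Q] [Finite Q]
    (hQ : Nat.card Q < Nat.card (alternatingGroup (Fin N)))
    (φ : (∀ i, A i) →* Q) (L : ℕ) :
    ∀ x : (∀ i, A i),
    (∀ i, x i ∈ {x | ∃ f : alternatingGroup (Fin N) →* A i, f (base N h5) = x} ^ L) → φ x = 1 := by
  induction L with
  | zero =>
    intro x hx
    have : x = 1 := by
      funext i
      simpa using hx i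
    rw [this, map_one]
  | succ L ih =>
    intro x hx
    simp only [pow_succ] at hx
    choose y hy z hz hyz using fun i => Set.mem_mul.1 (hx i)
    choose f hf using hz
    have hx : x = y * (MonoidHom.pi f : alternatingGroup (Fin N) →* (∀ i, A i)) (base N h5) := by
      funext i
      simp [hf, hyz]
    rw [hx, map_mul, ih y hy, one_mul]
    exact hom_trivial h5 hQ (φ.comp (MonoidHom.pi f)) _

end InterGrowthAux

open InterGrowthAux

theorem interGrowth_prod_alternating
    (n : ℕ → ℕ) (hn : StrictMono n) (h5 : 5 ≤ n 0) :
    ∀ k : ℕ,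
      interGrowth (∀ i : ℕ, alternatingGroup (Fin (n i))) (n k - 1) =
        ∏ i ∈ Finset.range k, Nat.card (alternatingGroup (Fin (n i))) := by
  intro k
  have hn5 : ∀ i, 5 ≤ n i := fun i => h5.trans (hn.monotone (Nat.zero_le i))
  let R : (∀ i : ℕ, alternatingGroup (Fin (n i))) →*
      (∀ i : Fin k, alternatingGroup (Fin (n i))) :=
    MonoidHom.pi fun i => Pi.evalMonoidHom _ (i : ℕ)
  have hR : Function.Surjective R := by
    intro y
    refine ⟨fun i => if h : i < k then y ⟨i, h⟩ else 1, ?_⟩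
    funext i
    simp [R]
  have key : interLambda (∀ i : ℕ, alternatingGroup (Fin (n i))) (n k - 1) = R.ker := by
    apply le_antisymm
    · intro x hx
      simp only [interLambda, Subgroup.mem_iInf] at hx
      rw [MonoidHom.mem_ker]
      funext i
      apply Subtype.ext
      apply Equiv.ext
      intro j
      have : MulAction.IsPretransitive (alternatingGroup (Fin (n i))) (Fin (n i)) :=
        alternatingGroup.isPretransitive_of_three_le_card _ (by have := hn5 i; simp; omega)
      have hidx : ((MulAction.stabilizer (alternatingGroup (Fin (n i))) j).comap
          (Pi.evalMonoidHom (fun i => alternatingGroup (Fin (n i))) (i : ℕ))).index = n i := by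
        rw [Subgroup.index_comap_of_surjective _ (Function.surjective_eval _),
          MulAction.index_stabilizer_of_transitive, Nat.card_fin]
      have hi : n i < n k := hn i.2
      have h := hx _ ⟨by rw [hidx]; have := hn5 i; omega, by rw [hidx]; omega⟩
      exact h
    · intro x hx
      simp only [interLambda, Subgroup.mem_iInf]
      rintro H ⟨h0, hle⟩
      have : H.FiniteIndex := ⟨h0⟩
      have hx' : ∀ i, i < k → x i = 1 := fun i hi => congrFun (MonoidHom.mem_ker.1 hx) ⟨i, hi⟩
      apply H.normalCore_le
      rw [Subgroup.normalCore_eq_ker, MonoidHom.mem_ker]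
      refine prod_trivial (hn5 k) ?_ _ (4 * n k) x ?_
      · rw [Nat.card_perm]
        exact factorial_lt_card_alt (hn5 k) hle
      · intro i
        rcases lt_or_ge i k with hi | hi
        · rw [hx' i hi]
          exact Set.one_mem_pow ⟨1, rfl⟩
        · exact mem_pow_good (hn5 k) (by simpa using hn.monotone hi) (x i)
  rw [interGrowth, key, Subgroup.index_ker, MonoidHom.range_eq_top.2 hR, Subgroup.card_top,
    Nat.card_pi, Finset.prod_range]
end

section
/- Let n : ℕ → ℕ be strictly increasing with n 0 ≥ 5, let G = Π i, alternatingGroup (Fin (n i)) be equipped with the product topology where each finite factor is discrete, and fix k : ℕ. Then the intersection of all open subgroups of G of index at most n k − 1 (i.e. ⨅ over H : Subgroup G with IsOpen (H : Set G), H.index ≠ 0 and H.index ≤ n k − 1) is exactly the subgroup {g ∈ G | ∀ i < k, g i = 1}, and this intersection has index ∏_{i < k} Nat.card (alternatingGroup (Fin (n i))). -/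
theorem alt_subgroup_eq_top {m : ℕ} (hm : 5 ≤ m) (K : Subgroup (alternatingGroup (Fin m)))
    (h : K.index < m) : K = ⊤ := by
  by_contra hK
  have hs : IsSimpleGroup (alternatingGroup (Fin m)) :=
    alternatingGroup.isSimpleGroup (by simpa using hm)
  have hcore : K.normalCore = ⊥ := by
    rcases (inferInstance : K.normalCore.Normal).eq_bot_or_eq_top with h1 | h1
    · exact h1
    · exact absurd (top_le_iff.mp (h1 ▸ K.normalCore_le)) hK
  have hinj : Function.Injective
      (MulAction.toPermHom (alternatingGroup (Fin m)) (alternatingGroup (Fin m) ⧸ K)) := by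
    rw [← MonoidHom.ker_eq_bot_iff, ← Subgroup.normalCore_eq_ker, hcore]
  have hc := Nat.card_le_card_of_injective _ hinj
  rw [Nat.card_perm] at hc
  have hc2 : Nat.card (alternatingGroup (Fin m)) ≤ (m - 1).factorial :=
    hc.trans (Nat.factorial_le (by change K.index ≤ _; omega))
  have : Nontrivial (Fin m) := Fin.nontrivial_iff_two_le.mpr (by omega)
  have h2 : 2 * Nat.card (alternatingGroup (Fin m)) = m.factorial := by
    have := two_mul_nat_card_alternatingGroup (α := Fin m)
    rw [this, Nat.card_perm]; simp
  obtain ⟨p, rfl⟩ : ∃ p, m = p + 1 := ⟨m - 1, by omega⟩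
  rw [Nat.factorial_succ] at h2
  simp only [Nat.add_sub_cancel] at hc2
  have := Nat.factorial_pos p
  nlinarith

theorem kerFirstCoords_index {G : ℕ → Type*} [∀ i, Group (G i)] (k : ℕ) :
    (kerFirstCoords (G := G) k).index = ∏ i ∈ Finset.range k, Nat.card (G i) := by
  let f : (∀ i, G i) →* (∀ i : Fin k, G i) :=
    { toFun := fun g i => g i, map_one' := rfl, map_mul' := fun _ _ => rfl }
  have hf : Function.Surjective f := by
    intro g
    refine ⟨fun i => if h : i < k then g ⟨i, h⟩ else 1, ?_⟩
    funext i
    simp [f]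
  have hk : kerFirstCoords (G := G) k = f.ker := by
    ext g
    rw [MonoidHom.mem_ker, funext_iff]
    exact ⟨fun h i => h i i.2, fun h i hi => h ⟨i, hi⟩⟩
  rw [hk, Subgroup.index_ker, MonoidHom.range_eq_top.mpr hf, Subgroup.card_top, Nat.card_pi,
    Finset.prod_range]

theorem inf_open_subgroups_eq_kerFirstCoords
    (n : ℕ → ℕ) (hn : StrictMono n) (h5 : 5 ≤ n 0) (k : ℕ)
    [∀ i, TopologicalSpace (alternatingGroup (Fin (n i)))]
    [∀ i, DiscreteTopology (alternatingGroup (Fin (n i)))] :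
    (⨅ (H : Subgroup (∀ i : ℕ, alternatingGroup (Fin (n i))))
        (_ : IsOpen (H : Set (∀ i : ℕ, alternatingGroup (Fin (n i)))) ∧
          H.index ≠ 0 ∧ H.index ≤ n k - 1), H) = kerFirstCoords k ∧
    (⨅ (H : Subgroup (∀ i : ℕ, alternatingGroup (Fin (n i))))
        (_ : IsOpen (H : Set (∀ i : ℕ, alternatingGroup (Fin (n i)))) ∧
          H.index ≠ 0 ∧ H.index ≤ n k - 1), H).index =
      ∏ i ∈ Finset.range k, Nat.card (alternatingGroup (Fin (n i))) := by
  have key : (⨅ (H : Subgroup (∀ i : ℕ, alternatingGroup (Fin (n i))))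
        (_ : IsOpen (H : Set (∀ i : ℕ, alternatingGroup (Fin (n i)))) ∧
          H.index ≠ 0 ∧ H.index ≤ n k - 1), H) = kerFirstCoords k := by
    apply le_antisymm
    · intro g hg i hi
      simp only [Subgroup.mem_iInf] at hg
      have hik : n i < n k := hn hi
      ext a
      let S : Subgroup (alternatingGroup (Fin (n i))) := MulAction.stabilizer _ a
      let p : (∀ i : ℕ, alternatingGroup (Fin (n i))) →* alternatingGroup (Fin (n i)) :=
        Pi.evalMonoidHom (fun i : ℕ => alternatingGroup (Fin (n i))) i
      have hp : Function.Surjective p := Function.surjective_eval i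
      have hidx : (S.comap p).index = S.index := Subgroup.index_comap_of_surjective _ hp
      have hmem : g ∈ S.comap p := by
        refine hg _ ⟨?_, ?_, ?_⟩
        · exact (isOpen_discrete (S : Set (alternatingGroup (Fin (n i))))).preimage
            (continuous_apply i)
        · rw [hidx]
          exact Subgroup.index_ne_zero_of_finite
        · rw [hidx, MulAction.index_stabilizer]
          have := Set.ncard_le_card (MulAction.orbit (alternatingGroup (Fin (n i))) a)
          simp at this
          omega
      have h2 : (g i) • a = a := hmem
      have h3 : (g i : Equiv.Perm (Fin (n i))) a = a := h2
      simp [h3]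
    · refine le_iInf fun H => le_iInf fun ⟨ho, h0, hi⟩ => ?_
      have hsingle : ∀ j, k ≤ j → ∀ x : alternatingGroup (Fin (n j)),
          (Pi.mulSingle j x : ∀ i : ℕ, alternatingGroup (Fin (n i))) ∈ H := by
        intro j hj x
        have hnj : n k ≤ n j := hn.monotone hj
        have h5j : 5 ≤ n j := h5.trans (hn.monotone (Nat.zero_le j))
        let s := MonoidHom.mulSingle (fun i : ℕ => alternatingGroup (Fin (n i))) j
        have hle : (H.comap s).index ≤ H.index := by
          rw [Subgroup.index_comap]
          rw [← Subgroup.relIndex_top_right] at h0 ⊢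
          exact Subgroup.relIndex_le_of_le_right le_top h0
        have := alt_subgroup_eq_top h5j (H.comap s) (by omega)
        have hx : x ∈ H.comap s := this ▸ Subgroup.mem_top x
        exact hx
      obtain ⟨m, hm⟩ : ∃ m, kerFirstCoords m ≤ H := by
        obtain ⟨I, u, hu, hI⟩ := isOpen_pi_iff.mp ho 1 H.one_mem
        refine ⟨I.sup id + 1, fun g hg => hI fun i hiI => ?_⟩
        have : i ≤ I.sup id := Finset.le_sup (f := id) hiI
        rw [hg i (by omega)]
        exact (hu i hiI).2
      have step : ∀ d, kerFirstCoords (k + d) ≤ H → kerFirstCoords k ≤ H := by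
        intro d
        induction d with
        | zero => exact id
        | succ d ih =>
          intro h
          apply ih
          intro g hg
          have h1 : (Pi.mulSingle (k + d) (g (k + d)))⁻¹ * g ∈ H := by
            apply h
            intro i hi
            by_cases hd : i = k + d
            · subst hd
              simp
            · have : g i = 1 := hg i (by omega)
              simp [Pi.mulSingle_eq_of_ne hd, this]
          have := H.mul_mem (hsingle (k + d) (by omega) (g (k + d))) h1
          simpa using this
      apply step m
      refine le_trans ?_ hm
      intro g hg i hi
      exact hg i (by omega)
  exact ⟨key, by rw [key]; exact kerFirstCoords_index k⟩
end

section
/- (Kassabov–Nikolov) Let n : ℕ → ℕ be strictly increasing with n 0 ≥ 5 and let G = Π k, alternatingGroup (Fin (n k)) be equipped with the product topology (each factor discrete). Then G is the profinite completion of a finitely generated residually finite group: there exist a finitely generated residually finite group Γ and an injective group homomorphism φ : Γ →* G whose image is dense in G, such that for every finite group Q and every surjective group homomorphism ψ : Γ →* Q there exists a continuous group homomorphism χ : G →* Q (Q discrete) with χ ∘ φ = ψ. -/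
/-- A group is residually finite if every nontrivial element avoids some
finite-index normal subgroup. -/
def ResiduallyFinite (Γ : Type*) [Group Γ] : Prop :=
  ∀ g : Γ, g ≠ 1 → ∃ H : Subgroup Γ, H.Normal ∧ H.index ≠ 0 ∧ g ∉ H

/-- The topological group `G` is the profinite completion of the finitely generated
residually finite group `Γ`: there is an injective homomorphism `φ : Γ →* G` with
dense image such that every surjection of `Γ` onto a finite (discrete) group `Q`
factors through `φ` via a continuous homomorphism `G →* Q`. -/
def IsProfiniteCompletionOfFGResFinite (G : Type*) [Group G] [TopologicalSpace G]
    (Γ : Type) [Group Γ] : Prop :=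
  Group.FG Γ ∧ ResiduallyFinite Γ ∧
    ∃ φ : Γ →* G, Function.Injective φ ∧ DenseRange φ ∧
      ∀ (Q : Type) [Group Q] [Finite Q] [TopologicalSpace Q] [DiscreteTopology Q]
        (ψ : Γ →* Q), Function.Surjective ψ →
          ∃ χ : G →* Q, Continuous χ ∧ ∀ g : Γ, χ (φ g) = ψ g


namespace KN

section Criterion

variable {G : ℕ → Type} [∀ k, Group (G k)] {Γ : Type} [Group Γ]

lemma normal_top {H : Type} [Group H] [IsSimpleGroup H] (N : Subgroup H) (hN : N.Normal)
    (x : H) (hx : x ∈ N) (hx1 : x ≠ 1) : N = ⊤ := by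
  rcases hN.eq_bot_or_eq_top with h | h
  · exact absurd (by simpa [h] using hx) hx1
  · exact h

lemma sep [∀ k, Finite (G k)] [∀ k, IsSimpleGroup (G k)]
    (hcard : Function.Injective fun k => Nat.card (G k))
    (p : Γ →* ∀ k, G k) (hs : ∀ k, ∀ x : G k, ∃ γ, p γ k = x)
    {j k : ℕ} (hjk : j ≠ k) (x : G k) : ∃ δ, p δ j = 1 ∧ p δ k = x := by
  let pj : Γ →* G j := (Pi.evalMonoidHom G j).comp p
  let pk : Γ →* G k := (Pi.evalMonoidHom G k).comp p
  have hpj : Function.Surjective pj := hs j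
  have hpk : Function.Surjective pk := hs k
  have hN : (pj.ker.map pk).Normal := Subgroup.Normal.map inferInstance pk hpk
  have hM : (pk.ker.map pj).Normal := Subgroup.Normal.map inferInstance pj hpj
  rcases hN.eq_bot_or_eq_top with h | h
  · exfalso
    have hle : pj.ker ≤ pk.ker := by
      rwa [Subgroup.map_eq_bot_iff] at h
    rcases hM.eq_bot_or_eq_top with h' | h'
    · have hle' : pk.ker ≤ pj.ker := by
        rwa [Subgroup.map_eq_bot_iff] at h'
      have he : pj.ker = pk.ker := le_antisymm hle hle'
      have h1 := Subgroup.index_ker pj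
      have h2 := Subgroup.index_ker pk
      rw [MonoidHom.range_eq_top.2 hpj] at h1
      rw [MonoidHom.range_eq_top.2 hpk] at h2
      rw [he, h2] at h1
      apply hjk
      apply hcard
      simpa using h1.symm
    · obtain ⟨y, hy⟩ := exists_ne (1 : G k)
      obtain ⟨γ, rfl⟩ := hpk y
      have : pj γ ∈ pk.ker.map pj := by rw [h']; trivial
      obtain ⟨δ, hδ, hδ'⟩ := this
      have h3 : γ * δ⁻¹ ∈ pj.ker := by
        rw [MonoidHom.mem_ker, map_mul, map_inv, hδ', mul_inv_cancel]
      have h4 := hle h3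
      rw [MonoidHom.mem_ker, map_mul, map_inv, MonoidHom.mem_ker.1 hδ] at h4
      exact hy (by simpa using h4)
  · have : x ∈ pj.ker.map pk := by rw [h]; trivial
    obtain ⟨δ, hδ, hδ'⟩ := this
    exact ⟨δ, hδ, hδ'⟩

lemma exists_noncomm {H : Type} [Group H] [IsSimpleGroup H] (hc : ∃ a b : H, a * b ≠ b * a)
    (x : H) (hx : x ≠ 1) : ∃ z, x * z ≠ z * x := by
  by_contra! hcon
  have h : Subgroup.center H = ⊤ := normal_top _ inferInstance x
    (Subgroup.mem_center_iff.2 fun g => (hcon g).symm) hx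
  obtain ⟨a, b, hab⟩ := hc
  have : b ∈ Subgroup.center H := by rw [h]; trivial
  exact hab (Subgroup.mem_center_iff.1 this a)

lemma exists_single_aux [∀ k, Finite (G k)] [∀ k, IsSimpleGroup (G k)]
    (hcard : Function.Injective fun k => Nat.card (G k))
    (hc : ∀ k, ∃ a b : G k, a * b ≠ b * a)
    (p : Γ →* ∀ k, G k) (hs : ∀ k, ∀ x : G k, ∃ γ, p γ k = x) (k : ℕ) (F : Finset ℕ) :
    ∀ γ, p γ k ≠ 1 → (∀ j, j ≠ k → j ∉ F → p γ j = 1) →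
      ∃ γ, p γ k ≠ 1 ∧ ∀ j, j ≠ k → p γ j = 1 := by
  induction F using Finset.induction_on with
  | empty => intro γ h1 h2; exact ⟨γ, h1, fun j hj => h2 j hj (by simp)⟩
  | insert i F hi ih =>
    intro γ h1 h2
    by_cases hik : i = k
    · exact ih γ h1 fun j hj hjF => h2 j hj (by simp [hjF, hik, hj])
    obtain ⟨z, hz⟩ := exists_noncomm (hc k) _ h1
    obtain ⟨δ, hδ1, hδ2⟩ := sep hcard p hs hik z
    refine ih (γ * δ * γ⁻¹ * δ⁻¹) ?_ ?_
    · simp only [map_mul, map_inv, Pi.mul_apply, Pi.inv_apply, hδ2]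
      intro h
      apply hz
      rw [mul_inv_eq_one] at h
      exact mul_inv_eq_iff_eq_mul.1 h
    · intro j hj hjF
      simp only [map_mul, map_inv, Pi.mul_apply, Pi.inv_apply]
      by_cases hji : j = i
      · subst hji; simp [hδ1]
      · rw [h2 j hj (by simp [hji, hjF])]; simp

lemma exists_single [∀ k, Finite (G k)] [∀ k, IsSimpleGroup (G k)]
    (hcard : Function.Injective fun k => Nat.card (G k))
    (hc : ∀ k, ∃ a b : G k, a * b ≠ b * a)
    (p : Γ →* ∀ k, G k) (hs : ∀ k, ∀ x : G k, ∃ γ, p γ k = x)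
    (hψ : ∀ (Q : Type) [Group Q] [Finite Q] (ψ : Γ →* Q),
      (∀ γ, (∃ K, ∀ k, K ≤ k → p γ k = 1) → ψ γ = 1) → ∀ γ, ψ γ = 1) (k : ℕ) (x : G k) :
    ∃ γ, p γ = Pi.mulSingle k x := by
  have h1 : ∃ γ, p γ k ≠ 1 ∧ ∃ K, ∀ k, K ≤ k → p γ k = 1 := by
    by_contra! hcon
    obtain ⟨y, hy⟩ := exists_ne (1 : G k)
    obtain ⟨γ, rfl⟩ := hs k y
    refine hy (hψ (G k) ((Pi.evalMonoidHom G k).comp p) ?_ γ)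
    rintro δ ⟨K, hK⟩
    by_contra h
    obtain ⟨j, hj, hj'⟩ := hcon δ h K
    exact hj' (hK j hj)
  obtain ⟨γ, hγ, K, hK⟩ := h1
  obtain ⟨γ, hγ, hγ'⟩ := exists_single_aux hcard hc p hs k (Finset.range K) γ hγ
    (fun j _ hj => hK j (by simpa using hj))
  have hsing : ∀ (γ : Γ), (∀ j, j ≠ k → p γ j = 1) → p γ = Pi.mulSingle k (p γ k) := by
    intro γ h
    funext j
    by_cases hj : j = k
    · subst hj; simp
    · rw [h j hj, Pi.mulSingle_eq_of_ne hj]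
  let N : Subgroup (G k) := p.range.comap (MonoidHom.mulSingle G k)
  have hN : N.Normal := by
    constructor
    rintro n ⟨δ, hδ⟩ g
    obtain ⟨ε, hε⟩ := hs k g
    refine ⟨ε * δ * ε⁻¹, ?_⟩
    change p δ = Pi.mulSingle k n at hδ
    change _ = Pi.mulSingle k (g * n * g⁻¹)
    rw [hsing]
    · simp [hδ, hε]
    · intro j hj
      simp [hδ, Pi.mulSingle_eq_of_ne hj]
  have hT := normal_top N hN (p γ k) ⟨γ, hsing γ hγ'⟩ hγ
  have : x ∈ N := by rw [hT]; trivial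
  exact this

/-- Truncation of a sequence to the first `K` coordinates. -/
def trunc (G : ℕ → Type) [∀ k, Group (G k)] (K : ℕ) : (∀ k, G k) →* ∀ k, G k where
  toFun x k := if k < K then x k else 1
  map_one' := by funext k; simp
  map_mul' x y := by funext k; by_cases h : k < K <;> simp [h]

lemma trunc_lt {K k : ℕ} (h : k < K) (x : ∀ k, G k) : trunc G K x k = x k := by
  simp [trunc, h]

lemma trunc_ge {K k : ℕ} (h : K ≤ k) (x : ∀ k, G k) : trunc G K x k = 1 := by
  simp [trunc, h]

lemma trunc_succ (K : ℕ) (x : ∀ k, G k) :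
    trunc G (K + 1) x = trunc G K x * Pi.mulSingle K (x K) := by
  funext k
  rcases lt_trichotomy k K with h | h | h
  · rw [Pi.mul_apply, trunc_lt (by omega), trunc_lt h, Pi.mulSingle_eq_of_ne (by omega), mul_one]
  · subst h
    rw [Pi.mul_apply, trunc_lt (by omega), trunc_ge le_rfl]; simp
  · rw [Pi.mul_apply, trunc_ge (by omega), trunc_ge h.le, Pi.mulSingle_eq_of_ne (by omega), mul_one]

lemma exists_trunc (p : Γ →* ∀ k, G k) (h1 : ∀ k (x : G k), ∃ γ, p γ = Pi.mulSingle k x)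
    (K : ℕ) (x : ∀ k, G k) : ∃ γ, p γ = trunc G K x := by
  induction K with
  | zero => exact ⟨1, by funext k; rw [trunc_ge (Nat.zero_le _)]; simp⟩
  | succ K ih =>
    obtain ⟨γ, hγ⟩ := ih
    obtain ⟨δ, hδ⟩ := h1 K (x K)
    exact ⟨γ * δ, by rw [map_mul, hγ, hδ, trunc_succ]⟩

theorem criterion [∀ k, TopologicalSpace (G k)] [∀ k, DiscreteTopology (G k)]
    [∀ k, Finite (G k)] [∀ k, IsSimpleGroup (G k)]
    (hcard : StrictMono fun k => Nat.card (G k))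
    (hc : ∀ k, ∃ a b : G k, a * b ≠ b * a) (hFG : Group.FG Γ)
    (p : Γ →* ∀ k, G k) (hp : Function.Injective p) (hs : ∀ k, ∀ x : G k, ∃ γ, p γ k = x)
    (hψ : ∀ (Q : Type) [Group Q] [Finite Q] (ψ : Γ →* Q),
      (∀ γ, (∃ K, ∀ k, K ≤ k → p γ k = 1) → ψ γ = 1) → ∀ γ, ψ γ = 1) :
    IsProfiniteCompletionOfFGResFinite (∀ k, G k) Γ := by
  have hsing := exists_single hcard.injective hc p hs hψ
  have htr := exists_trunc p hsing
  refine ⟨hFG, ?_, p, hp, ?_, ?_⟩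
  · intro g hg
    have : ∃ k, p g k ≠ 1 := by
      by_contra! h
      exact hg (hp (by rw [map_one]; funext k; exact h k))
    obtain ⟨k, hk⟩ := this
    refine ⟨((Pi.evalMonoidHom G k).comp p).ker, inferInstance, ?_, hk⟩
    rw [Subgroup.index_ker]
    exact Nat.card_pos.ne'
  · intro x
    rw [mem_closure_iff_nhds]
    intro t ht
    rw [nhds_pi, Filter.mem_pi] at ht
    obtain ⟨I, hI, U, hU, hsub⟩ := ht
    obtain ⟨K, hK⟩ := hI.bddAbove
    obtain ⟨γ, hγ⟩ := htr (K + 1) x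
    refine ⟨p γ, hsub ?_, ⟨γ, rfl⟩⟩
    intro i hi
    rw [hγ, trunc_lt (Nat.lt_succ_of_le (hK hi))]
    exact mem_of_mem_nhds (hU i)
  · intro Q _ _ _ _ ψ _
    choose ι hι using htr
    choose s hs1 using hsing
    have hιmul : ∀ K x y, ι K (x * y) = ι K x * ι K y := by
      intro K x y
      apply hp
      rw [map_mul, hι, hι, hι, map_mul]
    have hsmul : ∀ k x y, s k (x * y) = s k x * s k y := by
      intro K x y
      apply hp
      rw [map_mul, hs1, hs1, hs1, Pi.mulSingle_mul]
    -- large factors are killed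
    have hkill : ∀ k, Nat.card Q ≤ k → ∀ x, ψ (s k x) = 1 := by
      intro k hk x
      let θ : G k →* Q := MonoidHom.mk' (fun x => ψ (s k x)) (fun a b => by
        simp only [hsmul, map_mul])
      change θ x = 1
      have hni : ¬ Function.Injective θ := by
        intro hinj
        have h1 := Nat.card_le_card_of_injective θ hinj
        have h2 : k ≤ Nat.card (G k) := hcard.le_apply
        have h3 : k + 1 ≤ Nat.card (G (k + 1)) := hcard.le_apply
        have h4 : k < Nat.card (G k) := by
          clear h3
          have : ∀ k, k < Nat.card (G k) := by
            intro k
            induction k with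
            | zero => exact Nat.card_pos
            | succ k ih => exact lt_of_le_of_lt ih (hcard (Nat.lt_succ_self k))
          exact this k
        omega
      rcases (inferInstance : θ.ker.Normal).eq_bot_or_eq_top with h | h
      · exact absurd ((MonoidHom.ker_eq_bot_iff θ).1 h) hni
      · have : x ∈ θ.ker := by rw [h]; trivial
        exact this
    set K := Nat.card Q with hK
    let ιh : (∀ k, G k) →* Γ := MonoidHom.mk' (ι K) (hιmul K)
    have hιh : ∀ x, p (ιh x) = trunc G K x := fun x => hι K x
    have hfin : ∀ L γ, (∀ k, k < K → p γ k = 1) → (∀ k, L ≤ k → p γ k = 1) → ψ γ = 1 := by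
      intro L γ h1 h2
      have key : ∀ L, ψ (ι L (p γ)) = 1 := by
        intro L
        induction L with
        | zero =>
          have : ι 0 (p γ) = 1 := hp (by
            rw [hι, map_one]; funext k; rw [trunc_ge (Nat.zero_le _)]; rfl)
          rw [this, map_one]
        | succ L ih =>
          have : ι (L + 1) (p γ) = ι L (p γ) * s L (p γ L) := hp (by
            rw [map_mul, hι, hι, hs1, trunc_succ])
          rw [this, map_mul, ih, one_mul]
          by_cases hL : L < K
          · rw [h1 L hL]
            have : s L 1 = 1 := hp (by rw [hs1, map_one, Pi.mulSingle_one])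
            rw [this, map_one]
          · exact hkill L (not_lt.1 hL) _
      have : ι L (p γ) = γ := hp (by
        rw [hι]; funext k
        by_cases hk : k < L
        · rw [trunc_lt hk]
        · rw [trunc_ge (not_lt.1 hk), h2 k (not_lt.1 hk)])
      rw [← this]; exact key L
    refine ⟨ψ.comp ιh, ?_, ?_⟩
    · rw [continuous_discrete_rng]
      intro b
      rw [isOpen_iff_mem_nhds]
      intro x hx
      rw [nhds_pi, Filter.mem_pi]
      refine ⟨Set.Iio K, Set.finite_Iio K, fun k => {x k}, fun k => by simp, ?_⟩
      intro y hy
      have : ιh y = ιh x := hp (by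
        rw [hιh, hιh]; funext k
        by_cases hk : k < K
        · rw [trunc_lt hk, trunc_lt hk]; exact hy k hk
        · rw [trunc_ge (not_lt.1 hk), trunc_ge (not_lt.1 hk)])
      change ψ (ιh y) ∈ ({b} : Set Q)
      rw [this]; exact hx
    · intro γ
      let π : Γ →* Γ := MonoidHom.mk' (fun γ => (ιh (p γ))⁻¹ * γ) (fun a b => by
        apply hp
        funext k
        simp only [map_mul, map_inv, hιh, Pi.mul_apply, Pi.inv_apply]
        by_cases hk : k < K
        · simp [trunc_lt hk]
        · simp [trunc_ge (not_lt.1 hk)])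
      have hπ : ∀ γ, p (π γ) = (trunc G K (p γ))⁻¹ * p γ := by
        intro γ
        change p ((ιh (p γ))⁻¹ * γ) = _
        rw [map_mul, map_inv, hιh]
      have h := hψ Q (ψ.comp π) (by
        rintro δ ⟨L, hL⟩
        refine hfin (max K L) (π δ) ?_ ?_
        · intro k hk
          rw [hπ]; simp [trunc_lt hk]
        · intro k hk
          rw [hπ]; simp [trunc_ge (le_trans (le_max_left _ _) hk), hL k (le_trans (le_max_right _ _) hk)]) γ
      change ψ ((ιh (p γ))⁻¹ * γ) = 1 at h
      rw [map_mul, map_inv, inv_mul_eq_one] at h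
      exact h

end Criterion

section Layers

open Equiv
open scoped commutatorElement
set_option linter.unusedSimpArgs false

/-- The alternating group on five letters. -/
abbrev A5 : Type := alternatingGroup (Fin 5)

lemma perfect (P : Subgroup A5) (h : ∀ g k : A5, ⁅g, k⁆ ∈ P) : P = ⊤ := by
  rw [eq_top_iff, ← commutator_alternatingGroup_eq_top (α := Fin 5) (by simp), commutator_def,
    Subgroup.commutator_le]
  intro g _ k _
  exact h g k

/-- A fibrewise permutation of `Y × Fin 5`, acting in the second coordinate. -/
def Bh (Y : Type) : (Y → Perm (Fin 5)) →* Perm (Y × Fin 5) where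
  toFun G :=
    { toFun := fun x => (x.1, G x.1 x.2)
      invFun := fun x => (x.1, (G x.1)⁻¹ x.2)
      left_inv := fun x => by simp
      right_inv := fun x => by simp }
  map_one' := by ext x <;> rfl
  map_mul' G G' := by ext x <;> rfl

/-- A layerwise permutation of `Y × Fin 5`, acting in the first coordinate. -/
def Lh (Y : Type) : (Fin 5 → Perm Y) →* Perm (Y × Fin 5) where
  toFun F :=
    { toFun := fun x => (F x.2 x.1, x.2)
      invFun := fun x => ((F x.2)⁻¹ x.1, x.2)
      left_inv := fun x => by simp
      right_inv := fun x => by simp }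
  map_one' := by ext x <;> rfl
  map_mul' G G' := by ext x <;> rfl

@[simp] lemma Bh_apply (Y : Type) (G : Y → Perm (Fin 5)) (y : Y) (i : Fin 5) :
    Bh Y G (y, i) = (y, G y i) := rfl

@[simp] lemma Lh_apply (Y : Type) (F : Fin 5 → Perm Y) (y : Y) (i : Fin 5) :
    Lh Y F (y, i) = (F i y, i) := rfl

variable {Y : ℕ → Type}

/-- The ambient group. -/
abbrev V (Y : ℕ → Type) : Type := ∀ k, Perm (Y k × Fin 5)

open Classical in
/-- The copy of `A5` acting on the blocks in `U`. -/
noncomputable def aU (U : ∀ k, Set (Y k)) : A5 →* V Y where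
  toFun g k := Bh (Y k) (fun y => if y ∈ U k then (g : Perm (Fin 5)) else 1)
  map_one' := by
    funext k
    have : (fun y => if y ∈ U k then ((1 : A5) : Perm (Fin 5)) else 1) = 1 := by
      funext y; simp
    rw [this, map_one]; rfl
  map_mul' g h := by
    funext k
    rw [Pi.mul_apply, ← map_mul]
    congr 1
    funext y
    by_cases hy : y ∈ U k <;> simp [hy]

lemma aU_mem {U : ∀ k, Set (Y k)} {k : ℕ} {y : Y k} (h : y ∈ U k) (g : A5) (i : Fin 5) :
    aU U g k (y, i) = (y, (g : Perm (Fin 5)) i) := by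
  simp [aU, h]

lemma aU_notMem {U : ∀ k, Set (Y k)} {k : ℕ} {y : Y k} (h : y ∉ U k) (g : A5) (i : Fin 5) :
    aU U g k (y, i) = (y, i) := by
  simp [aU, h]

/-- The full sequence of sets. -/
def un (Y : ℕ → Type) : ∀ k, Set (Y k) := fun _ => Set.univ

lemma mem_un (k : ℕ) (y : Y k) : y ∈ un Y k := Set.mem_univ y

/-- Preimage of a sequence of sets. -/
def pre (T : ∀ k, Perm (Y k)) (U : ∀ k, Set (Y k)) : ∀ k, Set (Y k) := fun k => T k ⁻¹' U k

lemma aU_inv_mem {U : ∀ k, Set (Y k)} {k : ℕ} {y : Y k} (h : y ∈ U k) (g : A5) (i : Fin 5) :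
    (aU U g k)⁻¹ (y, i) = (y, (g⁻¹ : Perm (Fin 5)) i) := by
  rw [← Pi.inv_apply, ← map_inv, aU_mem h]; rfl

lemma aU_inv_notMem {U : ∀ k, Set (Y k)} {k : ℕ} {y : Y k} (h : y ∉ U k) (g : A5) (i : Fin 5) :
    (aU U g k)⁻¹ (y, i) = (y, i) := by
  rw [← Pi.inv_apply, ← map_inv, aU_notMem h]

lemma aU_inter (U W : ∀ k, Set (Y k)) (g h : A5) :
    aU (fun k => U k ∩ W k) ⁅g, h⁆ = ⁅aU U g, aU W h⁆ := by
  funext k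
  refine Equiv.ext ?_
  rintro ⟨y, i⟩
  simp only [commutatorElement_def, Pi.mul_apply, Pi.inv_apply, Perm.mul_apply]
  by_cases h1 : y ∈ U k <;> by_cases h2 : y ∈ W k
  · rw [aU_mem (show y ∈ (fun k => U k ∩ W k) k from ⟨h1, h2⟩)]
    simp only [aU_mem h1, aU_mem h2, aU_inv_mem h1, aU_inv_mem h2]
    rfl
  all_goals
    rw [aU_notMem (fun hh : y ∈ (fun k => U k ∩ W k) k => by first | exact h1 hh.1 | exact h2 hh.2)]
    simp [aU_mem, aU_inv_mem, aU_notMem, aU_inv_notMem, h1, h2]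

lemma aU_disj (U W : ∀ k, Set (Y k)) (hUW : ∀ k, Disjoint (U k) (W k)) (g : A5) :
    aU (fun k => U k ∪ W k) g = aU U g * aU W g := by
  funext k
  refine Equiv.ext ?_
  rintro ⟨y, i⟩
  simp only [Pi.mul_apply, Perm.mul_apply]
  by_cases h1 : y ∈ U k
  · have h2 : y ∉ W k := fun h => Set.disjoint_left.1 (hUW k) h1 h
    rw [aU_mem (show y ∈ (fun k => U k ∪ W k) k from Or.inl h1), aU_notMem h2, aU_mem h1]
  · by_cases h2 : y ∈ W k
    · rw [aU_mem (show y ∈ (fun k => U k ∪ W k) k from Or.inr h2), aU_mem h2, aU_notMem h1]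
    · rw [aU_notMem (show y ∉ (fun k => U k ∪ W k) k from fun h => h.elim h1 h2), aU_notMem h2,
        aU_notMem h1]

lemma aU_comm (U W : ∀ k, Set (Y k)) (hUW : ∀ k, Disjoint (U k) (W k)) (g h : A5) :
    aU U g * aU W h = aU W h * aU U g := by
  funext k
  refine Equiv.ext ?_
  rintro ⟨y, i⟩
  simp only [Pi.mul_apply, Perm.mul_apply]
  by_cases h1 : y ∈ U k
  · have h2 : y ∉ W k := fun h => Set.disjoint_left.1 (hUW k) h1 h
    simp [aU_mem h1, aU_notMem h2]
  · by_cases h2 : y ∈ W k <;> simp [aU_mem, aU_notMem, h1, h2]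

/-- `T` on layer `i`, `T⁻¹` on layer `j`. -/
def tau (T : ∀ k, Perm (Y k)) (i j : Fin 5) : V Y :=
  fun k => Lh (Y k) (Pi.mulSingle i (T k) * Pi.mulSingle j (T k)⁻¹)

/-- `T` on layers 0, 1, 2 and `T⁻³` on layer 3. -/
def rho (T : ∀ k, Perm (Y k)) : V Y := tau T 0 3 * tau T 1 3 * tau T 2 3

lemma rho_apply (T : ∀ k, Perm (Y k)) (k : ℕ) (y : Y k) :
    rho T k (y, 0) = (T k y, 0) ∧ rho T k (y, 1) = (T k y, 1) ∧ rho T k (y, 2) = (T k y, 2) ∧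
    rho T k (y, 3) = ((T k)⁻¹ ((T k)⁻¹ ((T k)⁻¹ y)), 3) ∧ rho T k (y, 4) = (y, 4) := by
  refine ⟨?_, ?_, ?_, ?_, ?_⟩ <;>
  simp [rho, tau, Pi.mulSingle, Function.update]

/-- A three-cycle. -/
def cc : A5 := ⟨swap 0 1 * swap 0 2, by rw [Perm.mem_alternatingGroup]; decide⟩

lemma cc_ne : cc ≠ 1 := by
  intro h
  have := congrArg (fun g : A5 => (g : Perm (Fin 5)) 0) h
  revert this
  decide

lemma rho_conj (T : ∀ k, Perm (Y k)) (U : ∀ k, Set (Y k)) :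
    aU U cc * rho T = rho T * aU (pre T U) cc := by
  funext k
  refine Equiv.ext ?_
  rintro ⟨y, i⟩
  simp only [Pi.mul_apply, Perm.mul_apply]
  obtain ⟨h0, h1, h2, h3, h4⟩ := rho_apply T k y
  have c0 : (cc : Perm (Fin 5)) 0 = 2 := by decide
  have c1 : (cc : Perm (Fin 5)) 1 = 0 := by decide
  have c2 : (cc : Perm (Fin 5)) 2 = 1 := by decide
  have c3 : (cc : Perm (Fin 5)) 3 = 3 := by decide
  have c4 : (cc : Perm (Fin 5)) 4 = 4 := by decide
  have fix3 : ∀ (W : ∀ k, Set (Y k)) (z : Y k), aU W cc k (z, 3) = (z, 3) := by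
    intro W z
    by_cases hz : z ∈ W k
    · rw [aU_mem hz, c3]
    · rw [aU_notMem hz]
  have fix4 : ∀ (W : ∀ k, Set (Y k)) (z : Y k), aU W cc k (z, 4) = (z, 4) := by
    intro W z
    by_cases hz : z ∈ W k
    · rw [aU_mem hz, c4]
    · rw [aU_notMem hz]
  by_cases hy : T k y ∈ U k
  · have hy' : y ∈ pre T U k := hy
    fin_cases i <;>
    simp [h0, h1, h2, h3, h4, aU_mem hy, aU_mem hy', c0, c1, c2, c3, c4, fix3, fix4]
  · have hy' : y ∉ pre T U k := hy
    fin_cases i <;>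
    simp [h0, h1, h2, h3, h4, aU_notMem hy, aU_notMem hy', c0, c1, c2, c3, c4, fix3, fix4]

lemma aU_univ_conj (U : ∀ k, Set (Y k)) (g h : A5) :
    aU U (g * h * g⁻¹) = aU (un Y) g * aU U h * (aU (un Y) g)⁻¹ := by
  funext k
  refine Equiv.ext ?_
  rintro ⟨y, i⟩
  have hu := mem_un k y
  simp only [Pi.mul_apply, Pi.inv_apply, Perm.mul_apply]
  by_cases h1 : y ∈ U k
  · simp only [aU_mem h1, aU_mem hu, aU_inv_mem hu]; rfl
  · simp only [aU_notMem h1, aU_mem hu, aU_inv_mem hu]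
    simp

lemma aU_tau_conj (T : ∀ k, Perm (Y k)) (g : A5) (i j : Fin 5) :
    aU (un Y) g * tau T i j =
      tau T ((g : Perm (Fin 5)) i) ((g : Perm (Fin 5)) j) * aU (un Y) g := by
  funext k
  refine Equiv.ext ?_
  rintro ⟨y, l⟩
  simp only [Pi.mul_apply, Perm.mul_apply, aU_mem (mem_un k _), tau, Lh_apply]
  have key : ∀ (i : Fin 5) (S : Perm (Y k)),
      (Pi.mulSingle i S : Fin 5 → Perm (Y k)) l =
      (Pi.mulSingle ((g : Perm (Fin 5)) i) S : Fin 5 → Perm (Y k)) ((g : Perm (Fin 5)) l) := by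
    intro i S
    by_cases h : l = i
    · subst h; simp
    · rw [Pi.mulSingle_eq_of_ne h, Pi.mulSingle_eq_of_ne]
      exact fun h' => h ((g : Perm (Fin 5)).injective h')
  rw [key i, key j]

lemma tau_mul (T : ∀ k, Perm (Y k)) (i j l : Fin 5) :
    tau T i j * tau T j l = tau T i l := by
  funext k
  simp only [tau, Pi.mul_apply, ← map_mul]
  congr 1
  have h : (Pi.mulSingle j (T k)⁻¹ : Fin 5 → Perm (Y k)) * Pi.mulSingle j (T k) = 1 := by
    rw [← Pi.mulSingle_mul]; simp
  rw [mul_assoc, ← mul_assoc (Pi.mulSingle j (T k)⁻¹ : Fin 5 → Perm (Y k)), h, one_mul]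

lemma tau_inv (T : ∀ k, Perm (Y k)) (i j : Fin 5) : tau T⁻¹ i j = tau T j i := by
  funext k
  simp only [tau, Pi.inv_apply, inv_inv]
  congr 1
  by_cases h : i = j
  · subst h; rw [← Pi.mulSingle_mul, ← Pi.mulSingle_mul]; simp
  · funext x
    by_cases h1 : x = i
    · subst h1; simp [Pi.mulSingle_eq_of_ne h]
    · simp [Pi.mulSingle_eq_of_ne h1]

end Layers

section Quotients

open Equiv
open scoped commutatorElement

variable {Y : ℕ → Type}

/-- All of `A5 ⊗ U` lies in `H`. -/
def InB (H : Subgroup (V Y)) (U : ∀ k, Set (Y k)) : Prop := ∀ g, aU U g ∈ H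

/-- All layer twists of `T` lie in `H`. -/
def Good (H : Subgroup (V Y)) (T : ∀ k, Perm (Y k)) : Prop := ∀ i j, tau T i j ∈ H

variable {H : Subgroup (V Y)}

lemma Good.inv {T : ∀ k, Perm (Y k)} (h : Good H T) : Good H T⁻¹ := by
  intro i j; rw [tau_inv]; exact h j i

lemma Good.rho {T : ∀ k, Perm (Y k)} (h : Good H T) : rho T ∈ H :=
  H.mul_mem (H.mul_mem (h _ _) (h _ _)) (h _ _)

lemma InB.inter {U W : ∀ k, Set (Y k)} (hU : InB H U) (hW : InB H W) :
    InB H (fun k => U k ∩ W k) := by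
  have : H.comap (aU (fun k => U k ∩ W k)) = ⊤ := by
    apply perfect
    intro g h
    rw [Subgroup.mem_comap, aU_inter, commutatorElement_def]
    exact H.mul_mem (H.mul_mem (H.mul_mem (hU _) (hW _)) (H.inv_mem (hU _))) (H.inv_mem (hW _))
  intro g
  have h : g ∈ H.comap (aU (fun k => U k ∩ W k)) := by rw [this]; trivial
  exact h

lemma aU_compl (U : ∀ k, Set (Y k)) (g : A5) :
    aU (un Y) g = aU U g * aU (fun k => (U k)ᶜ) g := by
  rw [← aU_disj _ _ (fun k => disjoint_compl_right)]
  congr 2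
  funext k
  simp [un]

lemma InB.compl {U : ∀ k, Set (Y k)} (hU : InB H U) (h1 : InB H (un Y)) :
    InB H (fun k => (U k)ᶜ) := by
  intro g
  have := aU_compl U g
  rw [← inv_mul_eq_iff_eq_mul] at this
  rw [← this]
  exact H.mul_mem (H.inv_mem (hU g)) (h1 g)

lemma InB.pre {U : ∀ k, Set (Y k)} {T : ∀ k, Perm (Y k)} (hU : InB H U) (h1 : InB H (un Y))
    (hT : Good H T) : InB H (pre T U) := by
  have hN : (H.comap (aU (KN.pre T U))).Normal := by
    constructor
    intro n hn g
    rw [Subgroup.mem_comap, aU_univ_conj]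
    exact H.mul_mem (H.mul_mem (h1 _) hn) (H.inv_mem (h1 _))
  have hc : cc ∈ H.comap (aU (KN.pre T U)) := by
    rw [Subgroup.mem_comap]
    have := rho_conj T U
    rw [← inv_mul_eq_iff_eq_mul] at this
    rw [← this]
    exact H.mul_mem (H.inv_mem hT.rho) (H.mul_mem (hU _) hT.rho)
  have := normal_top _ hN cc hc cc_ne
  intro g
  have h : g ∈ H.comap (aU (KN.pre T U)) := by rw [this]; trivial
  exact h

variable {Q : Type} [Group Q] (ψ : H →* Q)

/-- `A5 ⊗ U` lies in `H` and is killed by `ψ`. -/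
def Kill (U : ∀ k, Set (Y k)) : Prop := ∃ hB : InB H U, ∀ g, ψ ⟨aU U g, hB g⟩ = 1

variable {ψ}

/-- The restriction of `ψ` to `A5 ⊗ U`. -/
noncomputable def res (ψ : H →* Q) {U : ∀ k, Set (Y k)} (hU : InB H U) : A5 →* Q :=
  ψ.comp ((aU U).codRestrict H hU)

lemma res_apply {U : ∀ k, Set (Y k)} (hU : InB H U) (g : A5) :
    res ψ hU g = ψ ⟨aU U g, hU g⟩ := rfl

lemma Kill.pre {U : ∀ k, Set (Y k)} {T : ∀ k, Perm (Y k)} (h1 : InB H (un Y)) (hT : Good H T)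
    (hU : Kill ψ U) : Kill ψ (pre T U) := by
  obtain ⟨hB, hk⟩ := hU
  refine ⟨hB.pre h1 hT, ?_⟩
  have hc : cc ∈ (res ψ (hB.pre h1 hT)).ker := by
    rw [MonoidHom.mem_ker, res_apply]
    have e : (⟨aU (KN.pre T U) cc, hB.pre h1 hT cc⟩ : H) =
        (⟨rho T, hT.rho⟩ : H)⁻¹ * (⟨aU U cc, hB cc⟩ * ⟨rho T, hT.rho⟩) := by
      rw [eq_inv_mul_iff_mul_eq]
      apply Subtype.ext
      exact (rho_conj T U).symm
    rw [e, map_mul, map_mul, hk, one_mul, map_inv, inv_mul_cancel]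
  have := normal_top _ inferInstance cc hc cc_ne
  intro g
  have h : g ∈ (res ψ (hB.pre h1 hT)).ker := by rw [this]; trivial
  exact h

lemma pre_inv_pre (T : ∀ k, Perm (Y k)) (U : ∀ k, Set (Y k)) : pre T⁻¹ (pre T U) = U := by
  funext k; ext y; simp [pre]

lemma pre_pow_succ (T : ∀ k, Perm (Y k)) (U : ∀ k, Set (Y k)) (i : ℕ) :
    pre (T ^ (i + 1)) U = pre T (pre (T ^ i) U) := by
  funext k; ext y; simp [pre, pow_succ]

lemma Kill.of_pre_pow {U : ∀ k, Set (Y k)} {T : ∀ k, Perm (Y k)} (h1 : InB H (un Y))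
    (hT : Good H T) (i : ℕ) (hU : Kill ψ (KN.pre (T ^ i) U)) : Kill ψ U := by
  induction i with
  | zero =>
    have : KN.pre (T ^ 0) U = U := by funext k; ext y; simp [KN.pre]
    rwa [this] at hU
  | succ i ih =>
    rw [pre_pow_succ] at hU
    have := hU.pre h1 hT.inv
    rw [pre_inv_pre] at this
    exact ih this

lemma InB.pre_pow {U : ∀ k, Set (Y k)} {T : ∀ k, Perm (Y k)} (hU : InB H U)
    (h1 : InB H (un Y)) (hT : Good H T) (i : ℕ) : InB H (KN.pre (T ^ i) U) := by
  induction i with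
  | zero =>
    have : KN.pre (T ^ 0) U = U := by funext k; ext y; simp [KN.pre]
    rwa [this]
  | succ i ih =>
    rw [pre_pow_succ]
    exact ih.pre h1 hT

lemma Kill.union {U W : ∀ k, Set (Y k)} (hU : Kill ψ U) (hW : Kill ψ W)
    (hd : ∀ k, Disjoint (U k) (W k)) : Kill ψ (fun k => U k ∪ W k) := by
  obtain ⟨hB, hk⟩ := hU
  obtain ⟨hB', hk'⟩ := hW
  have e := fun g => aU_disj U W hd g
  refine ⟨fun g => by rw [e]; exact H.mul_mem (hB g) (hB' g), fun g => ?_⟩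
  have : (⟨aU (fun k => U k ∪ W k) g, by rw [e]; exact H.mul_mem (hB g) (hB' g)⟩ : H) =
      ⟨aU U g, hB g⟩ * ⟨aU W g, hB' g⟩ := Subtype.ext (e g)
  rw [this, map_mul, hk, hk', one_mul]

lemma aU_split (U W : ∀ k, Set (Y k)) (g : A5) :
    aU U g = aU (fun k => U k ∩ (W k)ᶜ) g * aU (fun k => U k ∩ W k) g := by
  rw [← aU_disj]
  · congr 2
    funext k
    rw [← Set.inter_union_distrib_left, Set.compl_union_self, Set.inter_univ]
  · intro k
    rw [Set.disjoint_left]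
    rintro y ⟨_, h⟩ ⟨_, h'⟩
    exact h h'

lemma kill_diff {U W : ∀ k, Set (Y k)} (h1 : InB H (un Y)) (hU : InB H U) (hW : InB H W)
    (he : res ψ hU = res ψ hW) : Kill ψ (fun k => U k ∩ (W k)ᶜ) := by
  have b1 : InB H (fun k => U k ∩ (W k)ᶜ) := hU.inter (hW.compl h1)
  have b2 : InB H (fun k => W k ∩ (U k)ᶜ) := hW.inter (hU.compl h1)
  have b3 : InB H (fun k => U k ∩ W k) := hU.inter hW
  have e1 : ∀ g, res ψ hU g = res ψ b1 g * res ψ b3 g := by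
    intro g
    rw [res_apply, res_apply, res_apply, ← map_mul]
    congr 1
    exact Subtype.ext (aU_split U W g)
  have e2 : ∀ g, res ψ hW g = res ψ b2 g * res ψ b3 g := by
    intro g
    rw [res_apply, res_apply, res_apply, ← map_mul]
    congr 1
    apply Subtype.ext
    have := aU_split W U g
    have hc : (fun k => W k ∩ U k) = (fun k => U k ∩ W k) := by
      funext k; exact Set.inter_comm _ _
    rw [hc] at this
    exact this
  have e3 : ∀ g, res ψ b1 g = res ψ b2 g := by
    intro g
    have := e1 g
    rw [he, e2] at this
    exact (mul_right_cancel this).symm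
  have e4 : ∀ g h, res ψ b1 g * res ψ b2 h = res ψ b2 h * res ψ b1 g := by
    intro g h
    rw [res_apply, res_apply, ← map_mul, ← map_mul]
    congr 1
    apply Subtype.ext
    refine aU_comm _ _ ?_ g h
    intro k
    rw [Set.disjoint_left]
    rintro y ⟨h1, _⟩ ⟨_, h2⟩
    exact h2 h1
  refine ⟨b1, ?_⟩
  have : (res ψ b1).ker = ⊤ := by
    apply perfect
    intro g h
    rw [MonoidHom.mem_ker, map_commutatorElement, commutatorElement_eq_one_iff_mul_comm]
    have := e4 g h
    rwa [← e3] at this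
  intro g
  have h : g ∈ (res ψ b1).ker := by rw [this]; trivial
  exact h

/-- The generating twists. -/
def twists (σ f : ∀ k, Perm (Y k)) : Set (V Y) :=
  Set.range (fun x : Fin 5 × Fin 5 => tau σ x.1 x.2) ∪
    Set.range (fun x : Fin 5 × Fin 5 => tau f x.1 x.2)

/-- The group generated by two copies of `A5` and the twists. -/
noncomputable def HH (U0 : ∀ k, Set (Y k)) (σ f : ∀ k, Perm (Y k)) : Subgroup (V Y) :=
  (aU (un Y)).range ⊔ (aU U0).range ⊔ Subgroup.closure (twists σ f)

lemma HH_un (U0 : ∀ k, Set (Y k)) (σ f : ∀ k, Perm (Y k)) : InB (HH U0 σ f) (un Y) := fun g =>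
  (le_sup_left.trans le_sup_left : (aU (un Y)).range ≤ HH U0 σ f) ⟨g, rfl⟩

lemma HH_U0 (U0 : ∀ k, Set (Y k)) (σ f : ∀ k, Perm (Y k)) : InB (HH U0 σ f) U0 := fun g =>
  (le_sup_right.trans le_sup_left : (aU U0).range ≤ HH U0 σ f) ⟨g, rfl⟩

lemma HH_σ (U0 : ∀ k, Set (Y k)) (σ f : ∀ k, Perm (Y k)) : Good (HH U0 σ f) σ := fun i j =>
  (le_sup_right : Subgroup.closure (twists σ f) ≤ HH U0 σ f)
    (Subgroup.subset_closure (Or.inl ⟨(i, j), rfl⟩))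

lemma HH_f (U0 : ∀ k, Set (Y k)) (σ f : ∀ k, Perm (Y k)) : Good (HH U0 σ f) f := fun i j =>
  (le_sup_right : Subgroup.closure (twists σ f) ≤ HH U0 σ f)
    (Subgroup.subset_closure (Or.inr ⟨(i, j), rfl⟩))

lemma HH_fg (U0 : ∀ k, Set (Y k)) (σ f : ∀ k, Perm (Y k)) : (HH U0 σ f).FG := by
  refine Subgroup.FG.sup (Subgroup.FG.sup ?_ ?_) ?_
  · rw [Subgroup.fg_iff]
    exact ⟨_, Subgroup.closure_eq _, Set.finite_range (aU (un Y))⟩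
  · rw [Subgroup.fg_iff]
    exact ⟨_, Subgroup.closure_eq _, Set.finite_range (aU U0)⟩
  · rw [Subgroup.fg_iff]
    exact ⟨_, rfl, (Set.finite_range _).union (Set.finite_range _)⟩

lemma HH_induct (U0 : ∀ k, Set (Y k)) (σ f : ∀ k, Perm (Y k)) (P : Subgroup (V Y))
    (h1 : InB P (un Y)) (h2 : InB P U0) (h3 : Good P σ) (h4 : Good P f) : HH U0 σ f ≤ P := by
  refine sup_le (sup_le ?_ ?_) ?_
  · rintro _ ⟨g, rfl⟩; exact h1 g
  · rintro _ ⟨g, rfl⟩; exact h2 g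
  · rw [Subgroup.closure_le]
    rintro _ (⟨x, rfl⟩ | ⟨x, rfl⟩)
    · exact h3 _ _
    · exact h4 _ _

lemma exists_perm (i j : Fin 5) (hij : i ≠ j) : ∃ l : Fin 5, ∃ g g' : A5,
    ((g : Perm (Fin 5)) i = j ∧ (g : Perm (Fin 5)) j = l) ∧
    ((g' : Perm (Fin 5)) i = i ∧ (g' : Perm (Fin 5)) j = l) := by
  obtain ⟨l, m, h1, h2, h3, h4, h5⟩ : ∃ l m : Fin 5, l ≠ i ∧ l ≠ j ∧ m ≠ i ∧ m ≠ j ∧ l ≠ m := by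
    revert i j; decide
  refine ⟨l, ⟨swap i j * swap j l, ?_⟩, ⟨swap j l * swap l m, ?_⟩, ⟨?_, ?_⟩, ?_, ?_⟩
  · rw [Perm.mem_alternatingGroup, map_mul, Perm.sign_swap hij, Perm.sign_swap h2.symm]; rfl
  · rw [Perm.mem_alternatingGroup, map_mul, Perm.sign_swap h2.symm, Perm.sign_swap h5]; rfl
  · rw [Perm.mul_apply, swap_apply_of_ne_of_ne hij h1.symm, swap_apply_left]
  · rw [Perm.mul_apply, swap_apply_left, swap_apply_of_ne_of_ne h1 h2]
  · rw [Perm.mul_apply, swap_apply_of_ne_of_ne h1.symm h3.symm,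
      swap_apply_of_ne_of_ne hij h1.symm]
  · rw [Perm.mul_apply, swap_apply_of_ne_of_ne h2.symm h4.symm, swap_apply_left]

lemma tau_self (T : ∀ k, Perm (Y k)) (i : Fin 5) : tau T i i = 1 := by
  have := tau_mul T i i i
  exact mul_eq_left.1 this

lemma kill_tau {T : ∀ k, Perm (Y k)} (h1 : Kill ψ (un Y)) (hT : Good H T) (i j : Fin 5) :
    ψ ⟨tau T i j, hT i j⟩ = 1 := by
  obtain ⟨hB, hk⟩ := h1
  have conj : ∀ (g : A5) (i j : Fin 5), ψ ⟨tau T i j, hT i j⟩ =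
      ψ ⟨tau T ((g : Perm (Fin 5)) i) ((g : Perm (Fin 5)) j), hT _ _⟩ := by
    intro g i j
    have e : (⟨aU (un Y) g, hB g⟩ : H) * ⟨tau T i j, hT i j⟩ =
        ⟨tau T ((g : Perm (Fin 5)) i) ((g : Perm (Fin 5)) j), hT _ _⟩ * ⟨aU (un Y) g, hB g⟩ :=
      Subtype.ext (aU_tau_conj T g i j)
    have := congrArg ψ e
    rwa [map_mul, map_mul, hk, one_mul, mul_one] at this
  by_cases hij : i = j
  · subst hij
    have : (⟨tau T i i, hT i i⟩ : H) = 1 := Subtype.ext (tau_self T i)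
    rw [this, map_one]
  · obtain ⟨l, g, g', ⟨a1, a2⟩, a3, a4⟩ := exists_perm i j hij
    have e1 := conj g i j
    have e2 := conj g' i j
    simp only [a1, a2] at e1
    simp only [a3, a4] at e2
    have e : (⟨tau T i j, hT i j⟩ : H) * ⟨tau T j l, hT j l⟩ = ⟨tau T i l, hT i l⟩ :=
      Subtype.ext (tau_mul T i j l)
    have := congrArg ψ e
    rw [map_mul, ← e1, ← e2] at this
    exact mul_eq_left.1 this

theorem noquot (U0 : ∀ k, Set (Y k)) (σ f : ∀ k, Perm (Y k))
    (hf : ∀ d, 0 < d → ∃ K, ∀ k, K ≤ k → ∀ y, (f k y ∈ U0 k ↔ y ∉ U0 k) ∧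
      (((σ k) ^ d) (f k y) ∈ U0 k ↔ ((σ k) ^ d) y ∈ U0 k))
    [Finite Q] (ψ : HH U0 σ f →* Q)
    (hψ : ∀ γ : HH U0 σ f, (∃ K, ∀ k, K ≤ k → (γ : V Y) k = 1) → ψ γ = 1) :
    ∀ γ, ψ γ = 1 := by
  have h1 := HH_un U0 σ f
  have h2 := HH_U0 U0 σ f
  have hσ := HH_σ U0 σ f
  have hff := HH_f U0 σ f
  have hUi := fun i => h2.pre_pow h1 hσ i
  have : Finite (A5 →* Q) := Finite.of_injective (fun φ : A5 →* Q => (φ : A5 → Q))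
    DFunLike.coe_injective
  obtain ⟨i, j, hij, he⟩ : ∃ i j : ℕ, i < j ∧ res ψ (hUi i) = res ψ (hUi j) := by
    obtain ⟨i, j, hne, he⟩ := Finite.exists_ne_map_eq_of_infinite (fun i => res ψ (hUi i))
    rcases lt_or_gt_of_ne hne with h | h
    · exact ⟨i, j, h, he⟩
    · exact ⟨j, i, h, he.symm⟩
  obtain ⟨d, rfl⟩ := Nat.exists_eq_add_of_lt hij
  set W := pre (σ ^ (d + 1)) U0 with hW
  have k1 : Kill ψ (fun k => U0 k ∩ (W k)ᶜ) := by
    refine Kill.of_pre_pow h1 hσ i ?_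
    convert kill_diff h1 _ _ he using 1
    funext k; ext y
    simp only [pre, W, Set.mem_preimage, Set.mem_inter_iff, Set.mem_compl_iff, Pi.pow_apply,
      ← Perm.mul_apply, ← pow_add]
    rw [show d + 1 + i = i + d + 1 by omega]
  have k2 : Kill ψ (fun k => W k ∩ (U0 k)ᶜ) := by
    refine Kill.of_pre_pow h1 hσ i ?_
    convert kill_diff h1 _ _ he.symm using 1
    funext k; ext y
    simp only [pre, W, Set.mem_preimage, Set.mem_inter_iff, Set.mem_compl_iff, Pi.pow_apply,
      ← Perm.mul_apply, ← pow_add]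
    rw [show d + 1 + i = i + d + 1 by omega]
  have k3 : Kill ψ (fun k => (U0 k ∩ (W k)ᶜ) ∪ (W k ∩ (U0 k)ᶜ)) := by
    refine k1.union k2 fun k => ?_
    rw [Set.disjoint_left]
    rintro y ⟨h, _⟩ ⟨_, h'⟩
    exact h' h
  set D : ∀ k, Set (Y k) := fun k => (U0 k ∩ (W k)ᶜ) ∪ (W k ∩ (U0 k)ᶜ) with hD
  have k4 : Kill ψ (pre f D) := k3.pre h1 hff
  obtain ⟨K, hK⟩ := hf (d + 1) (Nat.succ_pos d)
  have hcompl : ∀ k, K ≤ k → ∀ y, y ∈ pre f D k ↔ y ∉ D k := by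
    intro k hk y
    obtain ⟨a, b⟩ := hK k hk y
    have b' : f k y ∈ W k ↔ y ∈ W k := b
    simp only [pre, D, Set.mem_preimage, Set.mem_union, Set.mem_inter_iff, Set.mem_compl_iff, a, b']
    tauto
  obtain ⟨b3, k3⟩ := k3
  obtain ⟨b4, k4⟩ := k4
  have kun : Kill ψ (un Y) := by
    refine ⟨h1, fun g => ?_⟩
    have := hψ (⟨aU (un Y) g, h1 g⟩ * (⟨aU D g, b3 g⟩ * ⟨aU (pre f D) g, b4 g⟩)⁻¹) ⟨K, by
      intro k hk
      change aU (un Y) g k * (aU D g k * aU (pre f D) g k)⁻¹ = 1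
      rw [mul_inv_eq_one]
      refine Equiv.ext ?_
      rintro ⟨y, l⟩
      rw [aU_mem (mem_un k y), Perm.mul_apply]
      by_cases hy : y ∈ D k
      · rw [aU_notMem (fun h => (hcompl k hk y).1 h hy), aU_mem hy]
      · rw [aU_mem ((hcompl k hk y).2 hy), aU_notMem hy]⟩
    rwa [map_mul, map_inv, map_mul, k3, k4, one_mul, inv_one, mul_one] at this
  have kU0 : Kill ψ U0 := by
    refine ⟨h2, ?_⟩
    have : (res ψ h2).ker = ⊤ := by
      apply perfect
      intro g h
      rw [MonoidHom.mem_ker, res_apply]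
      have e : (⟨aU U0 ⁅g, h⁆, h2 _⟩ : HH U0 σ f) =
          ⁅(⟨aU (un Y) g, h1 g⟩ : HH U0 σ f), (⟨aU U0 h, h2 h⟩ : HH U0 σ f)⁆ := by
        apply Subtype.ext
        have := aU_inter (un Y) U0 g h
        have e : (fun k => un Y k ∩ U0 k) = U0 := by funext k; simp [un]
        rw [e] at this
        exact this
      rw [e, map_commutatorElement, kun.2 g]
      simp
    intro g
    have h : g ∈ (res ψ h2).ker := by rw [this]; trivial
    exact h
  have hle : HH U0 σ f ≤ ψ.ker.map (HH U0 σ f).subtype := by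
    apply HH_induct
    · intro g; exact ⟨⟨_, h1 g⟩, kun.2 g, rfl⟩
    · intro g; exact ⟨⟨_, h2 g⟩, kU0.2 g, rfl⟩
    · intro i j; exact ⟨⟨_, hσ i j⟩, kill_tau kun hσ i j, rfl⟩
    · intro i j; exact ⟨⟨_, hff i j⟩, kill_tau kun hff i j, rfl⟩
  rintro ⟨γ, hγ⟩
  obtain ⟨δ, hδ, e⟩ := hle hγ
  have : δ = ⟨γ, hγ⟩ := Subtype.ext e
  rw [← this]; exact hδ

end Quotients
section ThreeCycles

open Equiv

variable {X : Type} [DecidableEq X]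

/-- All three-cycles supported in `S` lie in `G`. -/
def TC (G : Subgroup (Perm X)) (S : Set X) : Prop :=
  ∀ a ∈ S, ∀ b ∈ S, ∀ c ∈ S, a ≠ b → a ≠ c → b ≠ c → swap a b * swap a c ∈ G

variable {G : Subgroup (Perm X)}

lemma TC.mono {S S' : Set X} (h : TC G S) (hs : S' ⊆ S) : TC G S' :=
  fun a ha b hb c hc => h a (hs ha) b (hs hb) c (hs hc)

lemma tc_conj (g : Perm X) (a b c : X) :
    g * (swap a b * swap a c) * g⁻¹ = swap (g a) (g b) * swap (g a) (g c) := by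
  rw [swap_apply_apply, swap_apply_apply]; group

lemma tc_conj_mem {g : Perm X} (hg : g ∈ G) {a b c : X} (h : swap a b * swap a c ∈ G) :
    swap (g a) (g b) * swap (g a) (g c) ∈ G := by
  rw [← tc_conj]
  exact G.mul_mem (G.mul_mem hg h) (G.inv_mem hg)

lemma tc_inv {a b c : X} (h : swap a b * swap a c ∈ G) : swap a c * swap a b ∈ G := by
  have := G.inv_mem h
  rwa [mul_inv_rev, swap_inv, swap_inv] at this

lemma tc_fst {a b c : X} (hac : a ≠ c) (hbc : b ≠ c) : (swap a b * swap a c) a = c := by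
  rw [Perm.mul_apply, swap_apply_left, swap_apply_of_ne_of_ne hac.symm hbc.symm]

lemma tc_snd {a b c : X} (hab : a ≠ b) (hbc : b ≠ c) : (swap a b * swap a c) b = a := by
  rw [Perm.mul_apply, swap_apply_of_ne_of_ne hab.symm hbc, swap_apply_right]

lemma tc_trd {a b c : X} : (swap a b * swap a c) c = b := by
  rw [Perm.mul_apply, swap_apply_right, swap_apply_left]

lemma tc_fix {a b c x : X} (ha : x ≠ a) (hb : x ≠ b) (hc : x ≠ c) :
    (swap a b * swap a c) x = x := by
  rw [Perm.mul_apply, swap_apply_of_ne_of_ne ha hc, swap_apply_of_ne_of_ne ha hb]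

lemma tc_cyc {a b c : X} (hab : a ≠ b) (hac : a ≠ c) (hbc : b ≠ c)
    (h : swap a b * swap a c ∈ G) : swap b c * swap b a ∈ G := by
  have := tc_conj_mem h h
  rw [tc_fst hac hbc, tc_snd hab hbc, tc_trd] at this
  have := tc_conj_mem h this
  rwa [tc_fst hac hbc, tc_snd hab hbc, tc_trd] at this

lemma TC.of_star {S : Set X} {p q : X} (hpq : p ≠ q)
    (h : ∀ x ∈ S, x ≠ p → x ≠ q → swap p q * swap p x ∈ G) : TC G S := by
  have h2 : ∀ x ∈ S, x ≠ p → x ≠ q → ∀ y ∈ S, y ≠ p → y ≠ q → x ≠ y →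
      swap x p * swap x y ∈ G := by
    intro x hx hxp hxq y hy hyp hyq hxy
    have := tc_conj_mem (h x hx hxp hxq) (h y hy hyp hyq)
    rwa [tc_fst hxp.symm hxq.symm, tc_snd hpq hxq.symm, tc_fix hyp hyq hxy.symm] at this
  have h3 : ∀ x ∈ S, x ≠ p → x ≠ q → ∀ y ∈ S, y ≠ p → y ≠ q → x ≠ y →
      swap q x * swap q y ∈ G := by
    intro x hx hxp hxq y hy hyp hyq hxy
    have := tc_conj_mem (tc_inv (h x hx hxp hxq)) (h y hy hyp hyq)
    rwa [tc_fst hpq hxq, tc_trd, tc_fix hyp hxy.symm hyq] at this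
  have h4 : ∀ z ∈ S, z ≠ p → z ≠ q → ∀ x ∈ S, x ≠ p → x ≠ q → ∀ y ∈ S, y ≠ p → y ≠ q →
      z ≠ x → z ≠ y → x ≠ y → swap z x * swap z y ∈ G := by
    intro z hz hzp hzq x hx hxp hxq y hy hyp hyq hzx hzy hxy
    have := tc_conj_mem (tc_inv (h z hz hzp hzq)) (h3 x hx hxp hxq y hy hyp hyq hxy)
    rwa [tc_trd, tc_fix hxp hzx.symm hxq, tc_fix hyp hzy.symm hyq] at this
  obtain ⟨P, hP⟩ : ∃ P : X → X → X → Prop, ∀ a b c, P a b c ↔ swap a b * swap a c ∈ G :=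
    ⟨_, fun _ _ _ => Iff.rfl⟩
  have s1 : ∀ a b c : X, a ≠ b → a ≠ c → b ≠ c → P a b c → P b c a := by
    intro a b c h1 h2 h3 h
    rw [hP] at *
    exact tc_cyc h1 h2 h3 h
  have s2 : ∀ a b c : X, P a b c → P a c b := by
    intro a b c h
    rw [hP] at *
    exact tc_inv h
  simp only [← hP] at h h2 h3 h4
  simp only [TC, ← hP]
  clear hP
  intro a ha b hb c hc hab hac hbc
  by_cases hap : a = p
  · by_cases hbq : b = q
    · grind
    · by_cases hcq : c = q <;> grind
  · by_cases haq : a = q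
    · by_cases hbp : b = p
      · grind
      · by_cases hcp : c = p <;> grind
    · by_cases hbp : b = p
      · by_cases hcq : c = q <;> grind
      · by_cases hbq : b = q
        · by_cases hcp : c = p <;> grind
        · by_cases hcp : c = p
          · grind
          · by_cases hcq : c = q <;> grind

lemma TC.merge {S S' : Set X} (h : TC G S) (h' : TC G S') {o p q u v : X}
    (ho : o ∈ S) (ho' : o ∈ S') (hp : p ∈ S) (hq : q ∈ S) (hop : o ≠ p) (hoq : o ≠ q)
    (hpq : p ≠ q) (hu : u ∈ S') (hv : v ∈ S') (hou : o ≠ u) (hov : o ≠ v) (huv : u ≠ v) :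
    TC G (S ∪ S') := by
  by_cases h2 : ∃ o', o' ≠ o ∧ o' ∈ S ∧ o' ∈ S'
  · obtain ⟨o', hne, h1, h2⟩ := h2
    refine TC.of_star hne.symm ?_
    rintro x (hx | hx) hxp hxq
    · exact h _ ho _ h1 _ hx hne.symm hxp.symm hxq.symm
    · exact h' _ ho' _ h2 _ hx hne.symm hxp.symm hxq.symm
  · push Not at h2
    have hpn : p ∉ S' := h2 p hop.symm hp
    have hqn : q ∉ S' := h2 q hoq.symm hq
    refine TC.of_star hpq ?_
    rintro x (hx | hx) hxp hxq
    · exact h _ hp _ hq _ hx hpq hxp.symm hxq.symm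
    · by_cases hxo : x = o
      · subst hxo
        exact h _ hp _ hq _ ho hpq hxp.symm hxq.symm
      · obtain ⟨w, hw, hwo, hwx⟩ : ∃ w ∈ S', w ≠ o ∧ w ≠ x := by
          by_cases hux : u = x
          · exact ⟨v, hv, hov.symm, fun e => huv (hux.trans e.symm)⟩
          · exact ⟨u, hu, hou.symm, hux⟩
        have hg := h' o ho' w hw x hx hwo.symm (Ne.symm hxo) hwx
        have := tc_conj_mem hg (h _ hp _ hq _ ho hpq hop.symm hoq.symm)
        rwa [tc_fst (Ne.symm hxo) hwx, tc_fix hop.symm (fun e => hpn (e ▸ hw)) hxp.symm,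
          tc_fix hoq.symm (fun e => hqn (e ▸ hw)) hxq.symm] at this

lemma TC.alt [Fintype X] (h : TC G Set.univ) : alternatingGroup X ≤ G := by
  rw [← Perm.closure_three_cycles_eq_alternating, Subgroup.closure_le]
  intro g hg
  have hg : g.IsThreeCycle := hg
  obtain ⟨a, ha⟩ : g.support.Nonempty := by
    rw [Finset.nonempty_iff_ne_empty, Ne, Perm.support_eq_empty_iff]
    exact hg.ne_one
  have e := hg.eq_swap_mul_swap_iff_mem_support.2 ha
  have hn := hg.nodup_iff_mem_support.2 ha
  simp only [List.nodup_cons, List.mem_cons, List.not_mem_nil, or_false, not_or] at hn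
  rw [SetLike.mem_coe, e, swap_comm a]
  exact h _ trivial _ trivial _ trivial (Ne.symm hn.1.1) hn.2.1 hn.1.2

lemma TC.of_alt [Fintype X] (h : alternatingGroup X ≤ G) : TC G Set.univ := by
  intro a _ b _ c _ hab hac hbc
  exact h (Perm.isThreeCycle_swap_mul_swap_same hab hac hbc).mem_alternatingGroup

end ThreeCycles
section Level

open Equiv

variable {Z : Type} [DecidableEq Z] {G : Subgroup (Perm (Z × Fin 5))}

/-- The block over `y`. -/
def blk (y : Z) : Set (Z × Fin 5) := {x | x.1 = y}

lemma link (hB : ∀ y, TC G (blk y)) (T : Perm Z)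
    (hT : Lh Z (Pi.mulSingle 0 T * Pi.mulSingle 4 T⁻¹) ∈ G) (y : Z) :
    TC G (blk y ∪ blk (T y)) := by
  by_cases hy : T y = y
  · rw [hy, Set.union_self]; exact hB y
  have h := tc_conj_mem hT (hB y (y, 0) rfl (y, 1) rfl (y, 2) rfl (by simp) (by simp) (by simp))
  have e0 : Lh Z (Pi.mulSingle 0 T * Pi.mulSingle 4 T⁻¹) (y, 0) = (T y, 0) := by
    simp [Pi.mulSingle, Function.update]
  have e1 : Lh Z (Pi.mulSingle 0 T * Pi.mulSingle 4 T⁻¹) (y, 1) = (y, 1) := by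
    simp [Pi.mulSingle, Function.update]
  have e2 : Lh Z (Pi.mulSingle 0 T * Pi.mulSingle 4 T⁻¹) (y, 2) = (y, 2) := by
    simp [Pi.mulSingle, Function.update]
  rw [e0, e1, e2] at h
  have h3 : TC G {(T y, 0), (y, 1), (y, 2)} := by
    refine TC.of_star (p := (y, 1)) (q := (y, 2)) (by simp) ?_
    rintro x (hx | hx | hx) h1 h2
    · rw [hx]
      exact tc_cyc (by simp) (by simp) (by simp) h
    · exact absurd hx h1
    · exact absurd hx h2
  have h4 := (hB y).merge h3 (o := (y, 1)) (p := (y, 3)) (q := (y, 4)) (u := (y, 2))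
    (v := (T y, 0)) rfl (by simp) rfl rfl (by simp) (by simp) (by simp) (by simp) (by simp)
    (by simp) (by simp) (by simp)
  refine (h4.merge (hB (T y)) (o := (T y, 0)) (p := (y, 1)) (q := (y, 2)) (u := (T y, 1))
    (v := (T y, 2)) (Or.inr (by simp)) rfl (Or.inl rfl) (Or.inl rfl) (by simp) (by simp) (by simp)
    rfl rfl (by simp) (by simp) (by simp)).mono ?_
  rintro x (hx | hx)
  · exact Or.inl (Or.inl hx)
  · exact Or.inr hx

lemma link_trans {y z w : Z} (h : TC G (blk y ∪ blk z)) (h' : TC G (blk z ∪ blk w)) :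
    TC G (blk y ∪ blk w) := by
  refine (h.merge h' (o := (z, 0)) (p := (z, 1)) (q := (z, 2)) (u := (z, 1)) (v := (z, 2))
    (Or.inr rfl) (Or.inl rfl) (Or.inr rfl) (Or.inr rfl) (by simp) (by simp) (by simp)
    (Or.inl rfl) (Or.inl rfl) (by simp) (by simp) (by simp)).mono ?_
  rintro x (hx | hx)
  · exact Or.inl (Or.inl hx)
  · exact Or.inr (Or.inr hx)

lemma link_all (y0 : Z) (h : ∀ y, TC G (blk y ∪ blk y0)) : TC G Set.univ := by
  refine TC.of_star (p := (y0, 0)) (q := (y0, 1)) (by simp) ?_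
  intro x _ h1 h2
  exact h x.1 _ (Or.inr rfl) _ (Or.inr rfl) _ (Or.inl rfl) (by simp) h1.symm h2.symm

/-- The rotation of coordinates. -/
def rotY (m : ℕ) : Perm (Fin m → Bool) where
  toFun y j := y (finRotate m j)
  invFun y j := y ((finRotate m).symm j)
  left_inv y := funext fun j => congrArg y ((finRotate m).apply_symm_apply j)
  right_inv y := funext fun j => congrArg y ((finRotate m).symm_apply_apply j)

/-- Flip of the coordinate `0`. -/
def flipY (m : ℕ) : Perm (Fin m → Bool) where
  toFun y j := if j.val = 0 then !y j else y j
  invFun y j := if j.val = 0 then !y j else y j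
  left_inv y := by funext j; by_cases h : j.val = 0 <;> simp [h]
  right_inv y := by funext j; by_cases h : j.val = 0 <;> simp [h]

/-- The half cube. -/
def halfY (m : ℕ) : Set (Fin m → Bool) := {y | ∀ j : Fin m, j.val = 0 → y j = false}

lemma rotY_pow (m i : ℕ) (y : Fin m → Bool) (j : Fin m) :
    (rotY m ^ i) y j = y (((finRotate m) ^ i) j) := by
  induction i generalizing y with
  | zero => rfl
  | succ i ih =>
    rw [pow_succ, Perm.mul_apply, ih, pow_succ', Perm.mul_apply]; rfl

lemma finRotate_pow (m i : ℕ) (hi : i < m) (j : Fin m) (hj : j.val = 0) :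
    ((finRotate m) ^ i) j = ⟨i, hi⟩ := by
  induction i with
  | zero => exact Fin.ext hj
  | succ i ih =>
    rw [pow_succ', Perm.mul_apply, ih (by omega)]
    obtain ⟨m, rfl⟩ : ∃ m', m = m' + 1 := ⟨m - 1, by omega⟩
    exact finRotate_of_lt (by omega)

lemma rotY_pow_mem (m i : ℕ) (hi : i < m) (y : Fin m → Bool) :
    (rotY m ^ i) y ∈ halfY m ↔ y ⟨i, hi⟩ = false := by
  constructor
  · intro h
    have := h ⟨0, by omega⟩ rfl
    rwa [rotY_pow, finRotate_pow m i hi _ rfl] at this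
  · intro h j hj
    rwa [rotY_pow, finRotate_pow m i hi _ hj]

lemma flip_rel (m : ℕ) (R : (Fin m → Bool) → (Fin m → Bool) → Prop)
    (hs : ∀ x y, R x y → R y x) (ht : ∀ x y z, R x y → R y z → R x z) (hr : ∀ x, R x x)
    (h1 : ∀ y, R y (rotY m y)) (h2 : ∀ y, R y (flipY m y)) (y : Fin m → Bool) :
    R y (fun _ => false) := by
  have hp : ∀ i y, R y ((rotY m ^ i) y) := by
    intro i
    induction i with
    | zero => exact hr
    | succ i ih =>
      intro y
      rw [pow_succ', Perm.mul_apply]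
      exact ht _ _ _ (ih y) (h1 _)
  have hu : ∀ (y : Fin m → Bool) (a : Fin m), R y (Function.update y a (!y a)) := by
    intro y a
    refine ht _ _ _ (hp a.val y) (ht _ _ _ (h2 _) (hs _ _ ?_))
    have := hp a.val (Function.update y a (!y a))
    convert this using 1
    funext j
    rw [rotY_pow]
    change (if j.val = 0 then !(rotY m ^ a.val) y j else (rotY m ^ a.val) y j) = _
    rw [rotY_pow]
    by_cases hj : j.val = 0
    · rw [finRotate_pow m a.val a.isLt j hj]; simp [hj]
    · rw [if_neg hj, Function.update_of_ne]
      intro e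
      have h0 := finRotate_pow m a.val a.isLt ⟨0, by omega⟩ rfl
      have : ((finRotate m) ^ a.val) j = ((finRotate m) ^ a.val) ⟨0, by omega⟩ := by
        rw [h0, e]
      exact hj (congrArg Fin.val (Equiv.injective _ this))
  have hi : ∀ (s : Finset (Fin m)) (y : Fin m → Bool), (∀ j, j ∉ s → y j = false) →
      R y (fun _ => false) := by
    intro s
    induction s using Finset.induction_on with
    | empty =>
      intro y hy
      have : y = fun _ => false := funext fun j => hy j (by simp)
      rw [this]; exact hr _
    | insert a s ha ih =>
      intro y hy
      by_cases h : y a = false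
      · exact ih y fun j hj => by
          by_cases hja : j = a
          · rw [hja, h]
          · exact hy j (by simp [hja, hj])
      · refine ht _ _ _ (hu y a) (ih _ fun j hj => ?_)
        by_cases hja : j = a
        · subst hja; simpa using h
        · rw [Function.update_of_ne hja]; exact hy j (by simp [hja, hj])
  exact hi Finset.univ y (by simp)

theorem level (m : ℕ) (G : Subgroup (Perm ((Fin m → Bool) × Fin 5)))
    (hB : ∀ y, TC G (blk y))
    (h1 : Lh _ (Pi.mulSingle 0 (rotY m) * Pi.mulSingle 4 (rotY m)⁻¹) ∈ G)
    (h2 : Lh _ (Pi.mulSingle 0 (flipY m) * Pi.mulSingle 4 (flipY m)⁻¹) ∈ G) :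
    TC G Set.univ := by
  refine link_all (fun _ => false) fun y => ?_
  refine flip_rel m (fun y z => TC G (blk y ∪ blk z)) ?_ ?_ ?_ ?_ ?_ y
  · intro x y h; rw [Set.union_comm]; exact h
  · intro x y z; exact link_trans
  · intro x; simp only [Set.union_self]; exact hB x
  · exact link hB _ h1
  · exact link hB _ h2

end Level
section Final

open Equiv
open scoped commutatorElement

section Signs

variable {Y : ℕ → Type} [∀ k, Fintype (Y k)] [∀ k, DecidableEq (Y k)]

/-- The sign of the `k`-th coordinate. -/
noncomputable def sgn (Y : ℕ → Type) [∀ k, Fintype (Y k)] [∀ k, DecidableEq (Y k)] (k : ℕ) :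
    V Y →* ℤˣ :=
  (Perm.sign (α := Y k × Fin 5)).comp (Pi.evalMonoidHom (fun k => Perm (Y k × Fin 5)) k)

lemma sgn_aU (U : ∀ k, Set (Y k)) (k : ℕ) (g : A5) : sgn Y k (aU U g) = 1 := by
  have : ((sgn Y k).comp (aU U)).ker = ⊤ := by
    apply perfect
    intro g h
    rw [MonoidHom.mem_ker, map_commutatorElement, commutatorElement_eq_one_iff_mul_comm, mul_comm]
  have h : g ∈ ((sgn Y k).comp (aU U)).ker := by rw [this]; trivial
  exact h

lemma sgn_tau (T : ∀ k, Perm (Y k)) (i j : Fin 5) (k : ℕ) : sgn Y k (tau T i j) = 1 := by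
  have hG : Good (⊤ : Subgroup (V Y)) T := fun _ _ => trivial
  have hK : Kill ((sgn Y k).comp (⊤ : Subgroup (V Y)).subtype) (un Y) :=
    ⟨fun _ => trivial, fun g => sgn_aU _ k g⟩
  exact kill_tau hK hG i j

lemma sgn_HH (U0 : ∀ k, Set (Y k)) (σ f : ∀ k, Perm (Y k)) {γ : V Y} (hγ : γ ∈ HH U0 σ f)
    (k : ℕ) : sgn Y k γ = 1 := by
  have : HH U0 σ f ≤ (sgn Y k).ker := by
    apply HH_induct
    · intro g; exact sgn_aU _ _ _
    · intro g; exact sgn_aU _ _ _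
    · intro i j; exact sgn_tau _ _ _ _
    · intro i j; exact sgn_tau _ _ _ _
  exact this hγ

end Signs

/-- The sequence of cubes. -/
abbrev YY (m : ℕ → ℕ) : ℕ → Type := fun k => Fin (m k) → Bool

/-- The main finitely generated group. -/
noncomputable def HM (m : ℕ → ℕ) : Subgroup (V (YY m)) :=
  HH (Y := YY m) (fun k => halfY (m k)) (fun k => rotY (m k)) (fun k => flipY (m k))

lemma exists_U (m : ℕ → ℕ) (k : ℕ) (y : YY m k) (s : ℕ) : ∃ U : ∀ k, Set (YY m k),
    InB (HM m) U ∧ ∀ z, z ∈ U k ↔ ∀ i : Fin (m k), i.val < s → z i = y i := by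
  have h1 : InB (HM m) (un (YY m)) := HH_un _ _ _
  have h2 : InB (HM m) (fun k => halfY (m k)) := HH_U0 _ _ _
  have hσ : Good (HM m) (fun k => rotY (m k)) := HH_σ _ _ _
  induction s with
  | zero => exact ⟨un _, h1, fun z => by simp [un]⟩
  | succ s ih =>
    obtain ⟨U, hU, hz⟩ := ih
    by_cases hs : s < m k
    · have hi := h2.pre_pow h1 hσ s
      have hmem : ∀ z : YY m k, z ∈ pre ((fun k => rotY (m k)) ^ s) (fun k => halfY (m k)) k ↔
          z ⟨s, hs⟩ = false := fun z => rotY_pow_mem (m k) s hs z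
      have hsplit : ∀ z : YY m k, (∀ i : Fin (m k), i.val < s + 1 → z i = y i) ↔
          (∀ i : Fin (m k), i.val < s → z i = y i) ∧ z ⟨s, hs⟩ = y ⟨s, hs⟩ := by
        intro z
        constructor
        · intro h; exact ⟨fun i hi => h i (by omega), h _ (by simp)⟩
        · rintro ⟨h, h'⟩ i hi
          rcases Nat.lt_succ_iff_lt_or_eq.1 hi with hi | hi
          · exact h i hi
          · have : i = ⟨s, hs⟩ := Fin.ext hi
            rw [this, h']
      cases hy : y ⟨s, hs⟩ with
      | false =>
        refine ⟨_, hU.inter hi, fun z => ?_⟩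
        rw [Set.mem_inter_iff, hz, hmem, hsplit, hy]
      | true =>
        refine ⟨_, hU.inter (hi.compl h1), fun z => ?_⟩
        rw [Set.mem_inter_iff, hz, Set.mem_compl_iff, hmem, hsplit, hy, Bool.not_eq_false]
    · refine ⟨U, hU, fun z => ?_⟩
      rw [hz]
      constructor
      · intro h i _; exact h i (by omega)
      · intro h i _; exact h i (by omega)

lemma TC_HM (m : ℕ → ℕ) (k : ℕ) :
    TC ((HM m).map (Pi.evalMonoidHom (fun k => Perm (YY m k × Fin 5)) k)) Set.univ := by
  apply level (m k)
  · rintro y ⟨y1, i⟩ h1 ⟨y2, j⟩ h2 ⟨y3, l⟩ h3 hij hil hjl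
    obtain rfl : y1 = y := h1
    obtain rfl : y2 = y1 := h2
    obtain rfl : y3 = y2 := h3
    have hij : i ≠ j := fun h => hij (by rw [h])
    have hil : i ≠ l := fun h => hil (by rw [h])
    have hjl : j ≠ l := fun h => hjl (by rw [h])
    obtain ⟨U, hU, hz⟩ := exists_U m k y3 (m k)
    have hz : ∀ z, z ∈ U k ↔ z = y3 := by
      intro z
      rw [hz]
      exact ⟨fun h => funext fun i => h i i.isLt, fun h i _ => by rw [h]⟩
    refine ⟨aU U ⟨swap i j * swap i l,
      (Perm.isThreeCycle_swap_mul_swap_same hij hil hjl).mem_alternatingGroup⟩, hU _, ?_⟩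
    refine Equiv.ext ?_
    rintro ⟨z, x⟩
    by_cases hzy : z = y3
    · subst hzy
      have sw : ∀ a b c : Fin 5, swap (z, a) (z, b) (z, c) = (z, swap a b c) := by
        intro a b c
        simp only [swap_apply_def, Prod.mk.injEq, true_and]
        split_ifs <;> rfl
      rw [Pi.evalMonoidHom_apply, aU_mem ((hz z).2 rfl)]
      simp only [Perm.mul_apply, sw]
    · rw [Pi.evalMonoidHom_apply, aU_notMem (fun h => hzy ((hz z).1 h)), tc_fix] <;>
      exact fun h => hzy (congrArg Prod.fst h)
  · exact ⟨_, HH_σ (Y := YY m) _ _ _ 0 4, rfl⟩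
  · exact ⟨_, HH_f (Y := YY m) _ _ _ 0 4, rfl⟩

theorem noquot_HM (m : ℕ → ℕ) (hm : ∀ d, ∃ K, ∀ k, K ≤ k → d < m k) {Q : Type} [Group Q]
    [Finite Q] (ψ : HM m →* Q)
    (hψ : ∀ γ : HM m, (∃ K, ∀ k, K ≤ k → (γ : V (YY m)) k = 1) → ψ γ = 1) : ∀ γ, ψ γ = 1 := by
  refine noquot _ _ _ ?_ ψ hψ
  intro d hd
  obtain ⟨K, hK⟩ := hm d
  refine ⟨K, fun k hk y => ?_⟩
  have hlt := hK k hk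
  have e0 : ∀ z : YY m k, z ∈ halfY (m k) ↔ z ⟨0, by omega⟩ = false := by
    intro z
    exact rotY_pow_mem (m k) 0 (by omega) z
  constructor
  · rw [e0, e0]
    change (if (0 : ℕ) = 0 then !y ⟨0, by omega⟩ else y ⟨0, by omega⟩) = false ↔ _
    simp
  · rw [rotY_pow_mem (m k) d hlt, rotY_pow_mem (m k) d hlt]
    change (if d = 0 then !y ⟨d, hlt⟩ else y ⟨d, hlt⟩) = false ↔ _
    rw [if_neg (by omega)]

section Embed

variable {X : ℕ → Type} {n : ℕ → ℕ}

/-- The homomorphism induced by a sequence of embeddings. -/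
noncomputable def EE (ε : ∀ k, X k ↪ Fin (n k)) : (∀ k, Perm (X k)) →* ∀ k, Perm (Fin (n k)) where
  toFun γ k := Perm.viaEmbeddingHom (ε k) (γ k)
  map_one' := by funext k; exact map_one _
  map_mul' γ δ := by funext k; exact map_mul _ _ _

lemma EE_apply (ε : ∀ k, X k ↪ Fin (n k)) (γ : ∀ k, Perm (X k)) (k : ℕ) :
    EE ε γ k = Perm.viaEmbeddingHom (ε k) (γ k) := rfl

lemma via_sign {A B : Type} [Fintype A] [DecidableEq A] [Fintype B] [DecidableEq B] (ε : A ↪ B)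
    (γ : Perm A) : Perm.sign (Perm.viaEmbeddingHom ε γ) = Perm.sign γ := by
  classical
  rw [Perm.viaEmbeddingHom_apply, Perm.viaEmbedding, Perm.sign_extendDomain]

lemma via_swap {A B : Type} [DecidableEq A] [DecidableEq B] (ε : A ↪ B) (a b : A) :
    Perm.viaEmbeddingHom ε (swap a b) = swap (ε a) (ε b) := by
  rw [Perm.viaEmbeddingHom_apply]
  refine Equiv.ext fun x => ?_
  by_cases hx : x ∈ Set.range ε
  · obtain ⟨c, rfl⟩ := hx
    rw [Perm.viaEmbedding_apply, ε.injective.swap_apply]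
  · rw [Perm.viaEmbedding_apply_of_notMem _ _ _ hx, swap_apply_of_ne_of_ne]
    · rintro rfl; exact hx ⟨a, rfl⟩
    · rintro rfl; exact hx ⟨b, rfl⟩

lemma TC_via {A B : Type} [DecidableEq A] [DecidableEq B] (ε : A ↪ B) (G : Subgroup (Perm A))
    (h : TC G Set.univ) : TC (G.map (Perm.viaEmbeddingHom ε)) (Set.range ε) := by
  rintro _ ⟨a, rfl⟩ _ ⟨b, rfl⟩ _ ⟨c, rfl⟩ hab hac hbc
  refine ⟨_, h a trivial b trivial c trivial (fun e => hab (by rw [e])) (fun e => hac (by rw [e]))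
    (fun e => hbc (by rw [e])), ?_⟩
  rw [map_mul, via_swap, via_swap]

end Embed

lemma TC.le {X : Type} [DecidableEq X] {G G' : Subgroup (Perm X)} {S : Set X} (h : TC G S)
    (hle : G ≤ G') : TC G' S :=
  fun a ha b hb c hc h1 h2 h3 => hle (h a ha b hb c hc h1 h2 h3)

lemma fg_map {A B : Type} [Group A] [Group B] (φ : A →* B) {H : Subgroup A} (h : H.FG) :
    (H.map φ).FG := by
  rw [Subgroup.fg_iff] at h ⊢
  obtain ⟨S, rfl, hS⟩ := h
  exact ⟨φ '' S, (φ.map_closure S).symm, hS.image φ⟩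

section Gamma

variable {m n : ℕ → ℕ} (ε ε' : ∀ k, (YY m k × Fin 5) ↪ Fin (n k))

/-- The group `Γ`. -/
noncomputable def GG : Subgroup (∀ k, Perm (Fin (n k))) := (HM m).map (EE ε) ⊔ (HM m).map (EE ε')

lemma GG_alt {γ : ∀ k, Perm (Fin (n k))} (hγ : γ ∈ GG ε ε') (k : ℕ) :
    γ k ∈ alternatingGroup (Fin (n k)) := by
  have : GG ε ε' ≤ (alternatingGroup (Fin (n k))).comap
      (Pi.evalMonoidHom (fun k => Perm (Fin (n k))) k) := by
    refine sup_le ?_ ?_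
    · rintro _ ⟨δ, hδ, rfl⟩
      rw [Subgroup.mem_comap, Perm.mem_alternatingGroup, Pi.evalMonoidHom_apply, EE_apply, via_sign]
      exact sgn_HH (Y := YY m) _ _ _ hδ k
    · rintro _ ⟨δ, hδ, rfl⟩
      rw [Subgroup.mem_comap, Perm.mem_alternatingGroup, Pi.evalMonoidHom_apply, EE_apply, via_sign]
      exact sgn_HH (Y := YY m) _ _ _ hδ k
  exact this hγ

/-- The embedding of `Γ` in the product. -/
noncomputable def pp : GG ε ε' →* ∀ k, alternatingGroup (Fin (n k)) where
  toFun γ k := ⟨(γ : ∀ k, Perm (Fin (n k))) k, GG_alt ε ε' γ.2 k⟩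
  map_one' := rfl
  map_mul' _ _ := rfl

lemma pp_injective : Function.Injective (pp ε ε') := by
  intro γ δ h
  apply Subtype.ext
  funext k
  exact congrArg Subtype.val (congrFun h k)

lemma TC_range (ε : ∀ k, (YY m k × Fin 5) ↪ Fin (n k)) (Γ : Subgroup (∀ k, Perm (Fin (n k))))
    (h : (HM m).map (EE ε) ≤ Γ) (k : ℕ) :
    TC (Γ.map (Pi.evalMonoidHom (fun k => Perm (Fin (n k))) k)) (Set.range (ε k)) := by
  refine (TC_via (ε k) _ (TC_HM m k)).le ?_
  rintro _ ⟨_, ⟨δ, hδ, rfl⟩, rfl⟩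
  exact ⟨EE ε δ, h ⟨δ, hδ, rfl⟩, rfl⟩

lemma pp_surj (hov : ∀ k, ∃ x y, ε k x = ε' k y)
    (hun : ∀ k, Set.range (ε k) ∪ Set.range (ε' k) = Set.univ)
    (k : ℕ) (x : alternatingGroup (Fin (n k))) : ∃ γ, pp ε ε' γ k = x := by
  have h1 := TC_range ε (GG ε ε') le_sup_left k
  have h2 := TC_range ε' (GG ε ε') le_sup_right k
  obtain ⟨⟨y, i⟩, ⟨z, j⟩, e⟩ := hov k
  have hex : ∀ i : Fin 5, ∃ p q : Fin 5, i ≠ p ∧ i ≠ q ∧ p ≠ q := by decide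
  obtain ⟨p, q, a1, a2, a3⟩ := hex i
  obtain ⟨u, v, b1, b2, b3⟩ := hex j
  have h3 := h1.merge h2 (o := ε k (y, i)) (p := ε k (y, p)) (q := ε k (y, q)) (u := ε' k (z, u))
    (v := ε' k (z, v)) ⟨_, rfl⟩ ⟨_, e.symm⟩ ⟨_, rfl⟩ ⟨_, rfl⟩ (by simpa using a1) (by simpa using a2)
    (by simpa using a3) ⟨_, rfl⟩ ⟨_, rfl⟩ (by rw [e]; simpa using b1) (by rw [e]; simpa using b2)
    (by simpa using b3)
  rw [hun] at h3
  obtain ⟨γ, hγ, hx⟩ := h3.alt x.2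
  exact ⟨⟨γ, hγ⟩, Subtype.ext hx⟩

lemma GG_noquot (hm : ∀ d, ∃ K, ∀ k, K ≤ k → d < m k) (Q : Type) [Group Q] [Finite Q]
    (ψ : GG ε ε' →* Q) (hψ : ∀ γ, (∃ K, ∀ k, K ≤ k → pp ε ε' γ k = 1) → ψ γ = 1) :
    ∀ γ, ψ γ = 1 := by
  have key : ∀ (e : ∀ k, (YY m k × Fin 5) ↪ Fin (n k)) (hle : (HM m).map (EE e) ≤ GG ε ε')
      (γ : HM m), ψ ⟨EE e γ, hle ⟨γ, γ.2, rfl⟩⟩ = 1 := by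
    intro e hle
    let j : HM m →* GG ε ε' :=
      { toFun := fun γ => ⟨EE e γ, hle ⟨γ, γ.2, rfl⟩⟩
        map_one' := Subtype.ext (map_one _)
        map_mul' := fun a b => Subtype.ext (map_mul _ _ _) }
    refine noquot_HM m hm (ψ.comp j) ?_
    rintro γ ⟨K, hK⟩
    refine hψ _ ⟨K, fun k hk => ?_⟩
    apply Subtype.ext
    change EE e γ k = 1
    rw [EE_apply, hK k hk, map_one]
  have hle : GG ε ε' ≤ ψ.ker.map (GG ε ε').subtype := by
    refine sup_le ?_ ?_
    · rintro _ ⟨δ, hδ, rfl⟩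
      exact ⟨_, key ε le_sup_left ⟨δ, hδ⟩, rfl⟩
    · rintro _ ⟨δ, hδ, rfl⟩
      exact ⟨_, key ε' le_sup_right ⟨δ, hδ⟩, rfl⟩
  rintro ⟨γ, hγ⟩
  obtain ⟨δ, hδ, e⟩ := hle hγ
  have : δ = ⟨γ, hγ⟩ := Subtype.ext e
  rw [← this]; exact hδ

lemma GG_fg : Group.FG (GG ε ε') := by
  rw [Group.fg_iff_subgroup_fg]
  exact (fg_map _ (HH_fg _ _ _)).sup (fg_map _ (HH_fg _ _ _))

end Gamma

lemma exists_emb (n : ℕ) (h : 5 ≤ n) : ∃ ε ε' : ((Fin (Nat.log 2 (n / 5)) → Bool) × Fin 5) ↪ Fin n,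
    (∃ x y, ε x = ε' y) ∧ Set.range ε ∪ Set.range ε' = Set.univ := by
  set m := Nat.log 2 (n / 5) with hm
  have h1 : 2 ^ m ≤ n / 5 := Nat.pow_log_le_self 2 (by omega)
  have h2 : n / 5 < 2 ^ (m + 1) := Nat.lt_pow_succ_log_self (by norm_num) _
  rw [pow_succ] at h2
  have h3 : 0 < 2 ^ m := by positivity
  generalize hM : 2 ^ m = M at *
  have hc : Fintype.card ((Fin m → Bool) × Fin 5) = M * 5 := by simp [hM]
  let e := Fintype.equivFinOfCardEq hc
  have hle : M * 5 ≤ n := by omega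
  let ε : ((Fin m → Bool) × Fin 5) ↪ Fin n := e.toEmbedding.trans (Fin.castLEEmb hle)
  let ε' : ((Fin m → Bool) × Fin 5) ↪ Fin n := ε.trans Fin.revPerm.toEmbedding
  have r1 : ∀ x : Fin n, x.val < M * 5 → ∃ z, ε z = x := by
    intro x hx
    refine ⟨e.symm ⟨x, hx⟩, ?_⟩
    apply Fin.ext
    simp [ε]
  have r2 : ∀ x : Fin n, n - 1 - x.val < M * 5 → ∃ z, ε' z = x := by
    intro x hx
    obtain ⟨z, hz⟩ := r1 (Fin.rev x) (by rw [Fin.val_rev]; omega)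
    refine ⟨z, ?_⟩
    change Fin.rev (ε z) = x
    rw [hz, Fin.rev_rev]
  refine ⟨ε, ε', ?_, ?_⟩
  · obtain ⟨x, hx⟩ := r1 ⟨M * 5 - 1, by omega⟩ (by simp only; omega)
    obtain ⟨y, hy⟩ := r2 ⟨M * 5 - 1, by omega⟩ (by simp only; omega)
    exact ⟨x, y, hx.trans hy.symm⟩
  · rw [Set.eq_univ_iff_forall]
    intro x
    by_cases hx : x.val < M * 5
    · exact Or.inl (r1 x hx)
    · exact Or.inr (r2 x (by have := x.isLt; omega))

lemma alt_noncomm (n : ℕ) (h : 5 ≤ n) : ∃ a b : alternatingGroup (Fin n), a * b ≠ b * a := by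
  by_contra! hcon
  have h1 : IsMulCommutative (alternatingGroup (Fin n)) := ⟨⟨hcon⟩⟩
  have := alternatingGroup.isMulCommutative_iff_card_le_three.1 h1
  simp at this
  omega

lemma alt_card (a b : ℕ) (h : 5 ≤ a) (hab : a < b) :
    Nat.card (alternatingGroup (Fin a)) < Nat.card (alternatingGroup (Fin b)) := by
  have : Nontrivial (Fin a) := Fin.nontrivial_iff_two_le.2 (by omega)
  have : Nontrivial (Fin b) := Fin.nontrivial_iff_two_le.2 (by omega)
  have h1 := two_mul_nat_card_alternatingGroup (α := Fin a)
  have h2 := two_mul_nat_card_alternatingGroup (α := Fin b)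
  rw [Nat.card_perm, Nat.card_eq_fintype_card (α := Fin a), Fintype.card_fin] at h1
  rw [Nat.card_perm, Nat.card_eq_fintype_card (α := Fin b), Fintype.card_fin] at h2
  have := (Nat.factorial_lt (by omega : 0 < a)).2 hab
  omega

end Final

end KN

theorem prod_alternating_is_profinite_completion
    (n : ℕ → ℕ) (hn : StrictMono n) (h5 : 5 ≤ n 0)
    [∀ k, TopologicalSpace (alternatingGroup (Fin (n k)))]
    [∀ k, DiscreteTopology (alternatingGroup (Fin (n k)))] :
    ∃ (Γ : Type) (inst : Group Γ),
      @IsProfiniteCompletionOfFGResFinite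
        (∀ k : ℕ, alternatingGroup (Fin (n k))) _ _ Γ inst := by
  have h5k : ∀ k, 5 ≤ n k := fun k => h5.trans (hn.monotone (Nat.zero_le k))
  choose ε ε' hov hun using fun k => KN.exists_emb (n k) (h5k k)
  have hm : ∀ d, ∃ K, ∀ k, K ≤ k → d < (fun k => Nat.log 2 (n k / 5)) k := by
    intro d
    refine ⟨5 * 2 ^ (d + 1), fun k hk => ?_⟩
    have h1 : k ≤ n k := hn.le_apply
    exact Nat.le_log_of_pow_le (by norm_num) (by omega)
  have hsimple : ∀ k, IsSimpleGroup (alternatingGroup (Fin (n k))) := fun k =>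
    alternatingGroup.isSimpleGroup (by simpa using h5k k)
  exact ⟨KN.GG (m := fun k => Nat.log 2 (n k / 5)) ε ε', inferInstance,
    KN.criterion (fun a b hab => KN.alt_card _ _ (h5k a) (hn hab))
      (fun k => KN.alt_noncomm _ (h5k k)) (KN.GG_fg _ _) (KN.pp ε ε') (KN.pp_injective _ _)
      (KN.pp_surj ε ε' hov hun)
      (fun Q _ _ ψ hψ => KN.GG_noquot (m := fun k => Nat.log 2 (n k / 5)) ε ε' hm Q ψ hψ)⟩
end
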